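/- arXiv:2309.14527 — 4 statements merged into one kernel-verified Lean document; each statement's English description precedes it below -/
import Mathlib

section
/- Let K be a finite-index subgroup of A and let r be a positive integer such that φ(K) ≤ K and a − φʳ(a) ∈ K for every a ∈ A (writing A additively). Then the subgroup Ḡ := ⟨K, tʳ⟩ of G generated by K and tʳ is a finite-index normal subgroup of G, and Ḡ ∩ A = K. -/
open Subgroup

/-- The free abelian group of rank `n`, written multiplicatively. -/
abbrev FreeAb (n : ℕ) : Type := Multiplicative (Fin n → ℤ)

/-- The isomorphism from `A = ⊤` onto the image `φ(A)` induced by an injective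
endomorphism `φ` of the free abelian group `A`. -/
noncomputable def ascIso {n : ℕ} (φ : FreeAb n →* FreeAb n) (hφ : Function.Injective φ) :
    (⊤ : Subgroup (FreeAb n)) ≃* φ.range :=
  Subgroup.topEquiv.trans (MonoidHom.ofInjective hφ)

/-- The ascending HNN extension `G = A∗_φ = ⟨A, t ∣ t·a·t⁻¹ = φ(a) for a ∈ A⟩`,
realized as the HNN extension of `A` over the subgroups `⊤` and `φ.range`. -/
abbrev AscHNN {n : ℕ} (φ : FreeAb n →* FreeAb n) (hφ : Function.Injective φ) : Type :=
  HNNExtension (FreeAb n) ⊤ φ.range (ascIso φ hφ)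

theorem asc_t_mul {n : ℕ} (φ : FreeAb n →* FreeAb n) (hφ : Function.Injective φ) (a : FreeAb n) :
    (HNNExtension.t : AscHNN φ hφ) * HNNExtension.of a = HNNExtension.of (φ a) * HNNExtension.t := by
  have h := HNNExtension.t_mul_of (φ := ascIso φ hφ) ⟨a, Subgroup.mem_top a⟩
  exact h

theorem asc_t_pow_mul {n : ℕ} (φ : FreeAb n →* FreeAb n) (hφ : Function.Injective φ) (k : ℕ)
    (a : FreeAb n) :
    (HNNExtension.t : AscHNN φ hφ) ^ k * HNNExtension.of a =
      HNNExtension.of ((⇑φ)^[k] a) * HNNExtension.t ^ k := by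
  induction k generalizing a with
  | zero => simp
  | succ k ih =>
    rw [pow_succ, mul_assoc, asc_t_mul, ← mul_assoc, ih, mul_assoc, Function.iterate_succ_apply]

theorem asc_normal {G A : Type*} [Group G] [Group A] (i : A →* G) (t : G) (φ : A →* A)
    (K : Subgroup A) (hA : ∀ a b, b ∈ K → a * b * a⁻¹ ∈ K) (r : ℕ) (hr : 0 < r)
    (ht : ∀ k a, t ^ k * i a = i ((⇑φ)^[k] a) * t ^ k)
    (hKinv : ∀ a ∈ K, φ a ∈ K)
    (hKr : ∀ a : A, a * ((⇑φ)^[r] a)⁻¹ ∈ K)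
    (hgen : ∀ H : Subgroup G, (∀ a, i a ∈ H) → t ∈ H → H = ⊤) :
    (Subgroup.closure (i '' (K : Set A) ∪ {t ^ r})).Normal := by
  set N := Subgroup.closure (i '' (K : Set A) ∪ {t ^ r}) with hN
  have hKN : ∀ a ∈ K, i a ∈ N := fun a ha => Subgroup.subset_closure (Or.inl ⟨a, ha, rfl⟩)
  have htN : t ^ r ∈ N := Subgroup.subset_closure (Or.inr rfl)
  have key : ∀ g : G, (∀ a ∈ K, g * i a * g⁻¹ ∈ N) → g * t ^ r * g⁻¹ ∈ N →
      ∀ x ∈ N, g * x * g⁻¹ ∈ N := by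
    intro g h1 h2
    have : N ≤ N.comap (MulAut.conj g).toMonoidHom := by
      conv_lhs => rw [hN]
      rw [Subgroup.closure_le]
      rintro x (⟨a, ha, rfl⟩ | hx)
      · exact h1 a ha
      · rw [Set.mem_singleton_iff] at hx
        subst hx
        exact h2
    exact fun x hx => this hx
  have hφk : ∀ k, ∀ a ∈ K, (⇑φ)^[k] a ∈ K := by
    intro k
    induction k with
    | zero => intro a ha; exact ha
    | succ k ih => intro a ha; exact ih _ (hKinv a ha)
  have hAN : ∀ a, ∀ x ∈ N, i a * x * (i a)⁻¹ ∈ N := by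
    intro a
    apply key
    · intro b hb
      have := hKN _ (hA a b hb)
      simpa using this
    · have h : i a * t ^ r * (i a)⁻¹ = i (a * ((⇑φ)^[r] a)⁻¹) * t ^ r := by
        have h3 := ht r a⁻¹
        rw [map_inv] at h3
        rw [mul_assoc, h3, ← mul_assoc, ← map_mul]
        simp [iterate_map_inv]
      rw [h]
      exact mul_mem (hKN _ (hKr a)) htN
  have htx : ∀ x ∈ N, t * x * t⁻¹ ∈ N := by
    apply key
    · intro b hb
      have h := ht 1 b
      simp only [pow_one, Function.iterate_one] at h
      rw [h, mul_inv_cancel_right]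
      exact hKN _ (hKinv b hb)
    · rw [← pow_succ', pow_succ, mul_inv_cancel_right]
      exact htN
  have htk : ∀ k : ℕ, ∀ x ∈ N, t ^ k * x * (t ^ k)⁻¹ ∈ N := by
    intro k
    induction k with
    | zero => intro x hx; simpa using hx
    | succ k ih =>
      intro x hx
      have := ih _ (htx x hx)
      rw [pow_succ]
      simpa [mul_assoc] using this
  have htinv : ∀ x ∈ N, t⁻¹ * x * t ∈ N := by
    intro x hx
    obtain ⟨m, rfl⟩ : ∃ m, r = m + 1 := ⟨r - 1, by omega⟩
    have h1 := mul_mem (mul_mem (inv_mem htN) (htk m x hx)) htN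
    have h2 : (t ^ (m + 1))⁻¹ * (t ^ m * x * (t ^ m)⁻¹) * t ^ (m + 1) = t⁻¹ * x * t := by
      rw [pow_succ]; group
    rwa [h2] at h1
  let M : Subgroup G :=
    { carrier := {g | (∀ x ∈ N, g * x * g⁻¹ ∈ N) ∧ (∀ x ∈ N, g⁻¹ * x * g ∈ N)}
      one_mem' := by simp
      mul_mem' := by
        rintro a b ⟨ha, ha'⟩ ⟨hb, hb'⟩
        refine ⟨fun x hx => ?_, fun x hx => ?_⟩
        · simpa [mul_assoc] using ha _ (hb x hx)
        · simpa [mul_assoc] using hb' _ (ha' x hx)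
      inv_mem' := by
        rintro a ⟨ha, ha'⟩
        exact ⟨by simpa using ha', by simpa using ha⟩ }
  have hM : M = ⊤ := by
    apply hgen
    · intro a
      exact ⟨hAN a, fun x hx => by simpa using hAN a⁻¹ x hx⟩
    · exact ⟨htx, htinv⟩
  refine ⟨fun x hx g => ?_⟩
  have : g ∈ M := hM ▸ Subgroup.mem_top g
  exact this.1 x hx

/-- Normal form: every element is `i a * t ^ k` up to the normal subgroup. -/
theorem asc_form {G A : Type*} [Group G] [Group A] (i : A →* G) (t : G) (φ : A →* A)
    (N : Subgroup G) [N.Normal] (r : ℕ) (hr : 0 < r)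
    (ht : ∀ k a, t ^ k * i a = i ((⇑φ)^[k] a) * t ^ k) (htN : t ^ r ∈ N)
    (hgen : ∀ H : Subgroup G, (∀ a, i a ∈ H) → t ∈ H → H = ⊤) (g : G) :
    ∃ (a : A) (k : ℕ), (i a * t ^ k)⁻¹ * g ∈ N := by
  have hq : ((t : G) : G ⧸ N) ^ r = 1 := by
    rw [← QuotientGroup.mk_pow]; exact (QuotientGroup.eq_one_iff _).2 htN
  have hinv : ∀ k : ℕ, ∃ l : ℕ, ((t : G ⧸ N) ^ k)⁻¹ = (t : G ⧸ N) ^ l := by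
    intro k
    refine ⟨(r - 1) * k, inv_eq_of_mul_eq_one_left ?_⟩
    rw [← pow_add, show (r - 1) * k + k = r * k by
      obtain ⟨m, rfl⟩ : ∃ m, r = m + 1 := ⟨r - 1, by omega⟩
      simp; ring, pow_mul, hq, one_pow]
  have htq : ∀ k a, (t : G ⧸ N) ^ k * (i a : G ⧸ N) = (i ((⇑φ)^[k] a) : G ⧸ N) * (t : G ⧸ N) ^ k := by
    intro k a
    have := congrArg (QuotientGroup.mk (s := N)) (ht k a)
    simpa using this
  let M : Subgroup G :=
    { carrier := {g | ∃ (a : A) (k : ℕ), (g : G ⧸ N) = (i a : G ⧸ N) * (t : G ⧸ N) ^ k}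
      one_mem' := ⟨1, 0, by simp⟩
      mul_mem' := by
        rintro x y ⟨a, k, hx⟩ ⟨b, l, hy⟩
        refine ⟨a * (⇑φ)^[k] b, k + l, ?_⟩
        rw [QuotientGroup.mk_mul, hx, hy, map_mul, QuotientGroup.mk_mul, pow_add, mul_assoc,
          ← mul_assoc _ _ ((t : G ⧸ N) ^ l), htq]
        simp only [mul_assoc]
      inv_mem' := by
        rintro x ⟨a, k, hx⟩
        obtain ⟨l, hl⟩ := hinv k
        refine ⟨(⇑φ)^[l] a⁻¹, l, ?_⟩
        rw [QuotientGroup.mk_inv, hx, mul_inv_rev, hl, ← htq, map_inv, QuotientGroup.mk_inv] }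
  have hM : M = ⊤ := by
    apply hgen
    · intro a
      exact ⟨a, 0, by simp⟩
    · exact ⟨1, 1, by simp⟩
  obtain ⟨a, k, h⟩ : g ∈ M := hM ▸ Subgroup.mem_top g
  refine ⟨a, k, ?_⟩
  rw [← QuotientGroup.eq, h]
  simp

theorem asc_gen {n : ℕ} (φ : FreeAb n →* FreeAb n) (hφ : Function.Injective φ)
    (H : Subgroup (AscHNN φ hφ)) (h1 : ∀ a, HNNExtension.of a ∈ H)
    (h2 : HNNExtension.t ∈ H) : H = ⊤ := by
  rw [eq_top_iff]
  intro g _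
  induction g using HNNExtension.induction_on with
  | of g => exact h1 g
  | t => exact h2
  | mul x y hx hy => exact mul_mem (hx trivial) (hy trivial)
  | inv x hx => exact inv_mem (hx trivial)

/-- A finite quotient of the ascending HNN extension separating `K` in `A`. -/
theorem asc_hom {n : ℕ} (φ : FreeAb n →* FreeAb n) (hφ : Function.Injective φ)
    (K : Subgroup (FreeAb n)) (r : ℕ) (hr : 0 < r)
    (hKinv : ∀ a ∈ K, φ a ∈ K)
    (hKr : ∀ a : FreeAb n, a * ((⇑φ)^[r] a)⁻¹ ∈ K) :
    ∃ (σ : Equiv.Perm (FreeAb n ⧸ K))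
      (f : AscHNN φ hφ →* Equiv.Perm (FreeAb n ⧸ K) × Multiplicative (ZMod r)),
      σ ^ r = 1 ∧ (f HNNExtension.t = (σ, Multiplicative.ofAdd 1)) ∧
      (∀ a, f (HNNExtension.of a) = (MulAction.toPermHom (FreeAb n) (FreeAb n ⧸ K) a, 1)) := by
  let ψ : FreeAb n ⧸ K →* FreeAb n ⧸ K := QuotientGroup.map K K φ hKinv
  have hψk : ∀ k a, (⇑ψ)^[k] (QuotientGroup.mk a) = QuotientGroup.mk ((⇑φ)^[k] a) := by
    intro k
    induction k with
    | zero => intro a; rfl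
    | succ k ih => intro a; exact ih (φ a)
  have hψr : ∀ x, (⇑ψ)^[r] x = x := by
    intro x
    induction x using QuotientGroup.induction_on with
    | H a =>
      rw [hψk, QuotientGroup.eq, mul_comm]
      exact hKr a
  obtain ⟨m, rfl⟩ : ∃ m, r = m + 1 := ⟨r - 1, by omega⟩
  let σ : Equiv.Perm (FreeAb n ⧸ K) :=
    { toFun := ψ
      invFun := (⇑ψ)^[m]
      left_inv := fun x => hψr x
      right_inv := fun x => (Function.iterate_succ_apply' (⇑ψ) m x).symm.trans (hψr x) }
  refine ⟨σ, HNNExtension.lift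
    (MonoidHom.prod (MulAction.toPermHom (FreeAb n) (FreeAb n ⧸ K)) 1)
    (σ, Multiplicative.ofAdd 1) ?_, ?_, ?_, ?_⟩
  · rintro ⟨a, ha⟩
    refine Prod.ext ?_ ?_
    · ext x
      induction x using QuotientGroup.induction_on with
      | H b =>
        change ψ (QuotientGroup.mk (a * b)) = QuotientGroup.mk (φ a * φ b)
        rw [← map_mul]; rfl
    · simp
  · ext x
    rw [← Equiv.Perm.iterate_eq_pow]
    exact hψr x
  · simp
  · intro a
    simp

/-- If `K` is a finite-index subgroup of `A` and `r > 0` satisfies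
`φ(K) ≤ K` and `a·φ^r(a)⁻¹ ∈ K` for all `a ∈ A`, then `Gbar := ⟨K, t^r⟩` is a
finite-index normal subgroup of `G = A∗_φ` and `Gbar ∩ A = K`. -/
theorem stmt_3 (n : ℕ) (hn : 1 ≤ n)
    (φ : FreeAb n →* FreeAb n) (hφ : Function.Injective φ)
    (K : Subgroup (FreeAb n)) (hKfi : K.FiniteIndex)
    (r : ℕ) (hr : 0 < r)
    (hKinv : ∀ a ∈ K, φ a ∈ K)
    (hKr : ∀ a : FreeAb n, a * ((⇑φ)^[r] a)⁻¹ ∈ K) :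
    Subgroup.Normal (Subgroup.closure
        ((HNNExtension.of : FreeAb n →* AscHNN φ hφ) '' (K : Set (FreeAb n)) ∪
          {(HNNExtension.t : AscHNN φ hφ) ^ r})) ∧
    Subgroup.FiniteIndex (Subgroup.closure
        ((HNNExtension.of : FreeAb n →* AscHNN φ hφ) '' (K : Set (FreeAb n)) ∪
          {(HNNExtension.t : AscHNN φ hφ) ^ r})) ∧
    Subgroup.comap (HNNExtension.of : FreeAb n →* AscHNN φ hφ)
        (Subgroup.closure
          ((HNNExtension.of : FreeAb n →* AscHNN φ hφ) '' (K : Set (FreeAb n)) ∪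
            {(HNNExtension.t : AscHNN φ hφ) ^ r})) = K := by
  have hgen := asc_gen φ hφ
  have hpow := asc_t_pow_mul φ hφ
  obtain ⟨σ, f, hσ, hft, hfa⟩ := asc_hom φ hφ K r hr hKinv hKr
  have hnorm := asc_normal (HNNExtension.of : FreeAb n →* AscHNN φ hφ) HNNExtension.t φ K
    (fun a b hb => by rwa [mul_inv_cancel_comm]) r hr hpow hKinv hKr hgen
  set N := Subgroup.closure
        ((HNNExtension.of : FreeAb n →* AscHNN φ hφ) '' (K : Set (FreeAb n)) ∪
          {(HNNExtension.t : AscHNN φ hφ) ^ r}) with hN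
  have hKN : ∀ a ∈ K, HNNExtension.of a ∈ N :=
    fun a ha => Subgroup.subset_closure (Or.inl ⟨a, ha, rfl⟩)
  have htN : HNNExtension.t ^ r ∈ N := Subgroup.subset_closure (Or.inr rfl)
  have hperm : ∀ a, MulAction.toPermHom (FreeAb n) (FreeAb n ⧸ K) a = 1 ↔ a ∈ K := by
    intro a
    constructor
    · intro h
      have h1 := Equiv.congr_fun h (QuotientGroup.mk 1)
      change (QuotientGroup.mk (a * 1) : FreeAb n ⧸ K) = QuotientGroup.mk 1 at h1
      rw [mul_one] at h1
      exact (QuotientGroup.eq_one_iff a).1 h1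
    · intro h
      ext x
      induction x using QuotientGroup.induction_on with
      | H b =>
        change (QuotientGroup.mk (a * b) : FreeAb n ⧸ K) = QuotientGroup.mk b
        rw [QuotientGroup.mk_mul, (QuotientGroup.eq_one_iff a).2 h, one_mul]
  have hr1 : (Multiplicative.ofAdd (1 : ZMod r)) ^ r = 1 := by
    rw [← ofAdd_nsmul]; simp
  have hNf : N ≤ f.ker := by
    rw [hN, Subgroup.closure_le]
    rintro x (⟨a, ha, rfl⟩ | hx)
    · change f _ = 1
      rw [hfa, (hperm a).2 ha]; rfl
    · rw [Set.mem_singleton_iff] at hx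
      subst hx
      change f _ = 1
      rw [map_pow, hft, Prod.pow_mk, hσ, hr1]; rfl
  have hfN : f.ker ≤ N := by
    intro g hg
    obtain ⟨a, k, hk⟩ := asc_form (HNNExtension.of : FreeAb n →* AscHNN φ hφ) HNNExtension.t φ N
      r hr hpow htN hgen g
    have h1 : f (HNNExtension.of a * HNNExtension.t ^ k) = 1 := by
      have h2 : f _ = 1 := hNf hk
      rw [map_mul, (show f g = 1 from hg), mul_one, map_inv, inv_eq_one] at h2
      exact h2
    rw [map_mul, map_pow, hft, hfa, Prod.pow_mk, Prod.mk_mul_mk, Prod.mk_eq_one, one_mul,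
      ← ofAdd_nsmul, ofAdd_eq_one, nsmul_eq_mul, mul_one, ZMod.natCast_eq_zero_iff] at h1
    obtain ⟨h1, m, rfl⟩ := h1
    rw [pow_mul, hσ, one_pow, mul_one, hperm] at h1
    have h3 := mul_mem (mul_mem (hKN a h1) (pow_mem htN m)) hk
    rw [← pow_mul, mul_inv_cancel_left] at h3
    exact h3
  refine ⟨hnorm, ?_, ?_⟩
  · have : NeZero r := ⟨hr.ne'⟩
    have : Finite (FreeAb n ⧸ K) := Subgroup.finite_quotient_of_finiteIndex
    have : Finite (Multiplicative (ZMod r)) := inferInstanceAs (Finite (ZMod r))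
    have : f.ker.FiniteIndex := inferInstance
    exact Subgroup.finiteIndex_of_le hfN
  · ext a
    rw [Subgroup.mem_comap]
    refine ⟨fun h => ?_, hKN a⟩
    have h1 : f _ = 1 := hNf h
    rw [hfa, Prod.mk_eq_one] at h1
    exact (hperm a).1 h1.1
end

section
/- G is cyclic subgroup separable if and only if for every nontrivial a ∈ A, every prime p, and every s ≥ 1, there exists a finite-index normal subgroup Ḡ of G such that the order of the image of a in the finite quotient G/Ḡ is a multiple of pˢ. -/
open Subgroup Pointwise

section Helpers

theorem not_mem_mul_iff {G : Type*} [Group G] (g h : G) (N : Subgroup G) :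
    h ∉ ((Subgroup.zpowers g : Set G) * (N : Set G)) ↔ ∀ m : ℤ, (g ^ m)⁻¹ * h ∉ N := by
  constructor
  · intro H m hm
    exact H (Set.mem_mul.2 ⟨g ^ m, ⟨m, rfl⟩, _, hm, by group⟩)
  · intro H hm
    obtain ⟨_, ⟨m, rfl⟩, y, hy, hxy⟩ := Set.mem_mul.1 hm
    apply H m
    rw [← hxy]
    simpa using hy

/-- `h` can be separated from the cyclic subgroup generated by `g`. -/
def CycSep {G : Type*} [Group G] (g h : G) : Prop :=
  ∃ N : Subgroup G, N.Normal ∧ N.FiniteIndex ∧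
    h ∉ ((Subgroup.zpowers g : Set G) * (N : Set G))

theorem CycSep.of_hom {G K : Type*} [Group G] [Group K] [Finite K] (f : G →* K) (g h : G)
    (H : ∀ m : ℤ, f h ≠ f g ^ m) : CycSep g h := by
  refine ⟨f.ker, inferInstance, inferInstance, ?_⟩
  rw [not_mem_mul_iff]
  intro m hm
  apply H m
  rw [MonoidHom.mem_ker, map_mul, map_inv, map_zpow, inv_mul_eq_one] at hm
  exact hm.symm

theorem CycSep.of_conj {G : Type*} [Group G] (c g h : G)
    (H : CycSep (c * g * c⁻¹) (c * h * c⁻¹)) : CycSep g h := by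
  obtain ⟨N, hN, hf, H⟩ := H
  refine ⟨N, hN, hf, ?_⟩
  rw [not_mem_mul_iff] at H ⊢
  intro m hm
  apply H m
  have := hN.conj_mem _ hm c
  rw [conj_zpow]
  convert this using 1
  group

theorem CycSep.of_mul_zpow {G : Type*} [Group G] (g h : G) (k : ℤ)
    (H : CycSep g (g ^ k * h)) : CycSep g h := by
  obtain ⟨N, hN, hf, H⟩ := H
  refine ⟨N, hN, hf, ?_⟩
  rw [not_mem_mul_iff] at H ⊢
  intro m hm
  apply H (k + m)
  convert hm using 1
  group

/-- homomorphisms to `ℤ` -/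
theorem CycSep.of_int {G : Type*} [Group G] (f : G →* Multiplicative ℤ) (g h : G)
    (H : ¬ (f g).toAdd ∣ (f h).toAdd) : CycSep g h := by
  obtain ⟨d, hd0, hdg, hdh⟩ : ∃ d : ℕ, d ≠ 0 ∧ (d : ℤ) ∣ (f g).toAdd ∧ ¬ (d : ℤ) ∣ (f h).toAdd := by
    by_cases h0 : (f g).toAdd = 0
    · have h1 : (f h).toAdd ≠ 0 := by
        rintro h1; rw [h0, h1] at H; simp at H
      refine ⟨(f h).toAdd.natAbs + 1, by omega, by simp [h0], fun hd => ?_⟩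
      have := Int.natAbs_dvd_natAbs.2 hd
      have := Nat.le_of_dvd (by omega) this
      simp only [Int.natAbs_natCast] at this
      omega
    · exact ⟨(f g).toAdd.natAbs, by simpa using h0, by simp, by simpa using H⟩
  haveI : NeZero d := ⟨hd0⟩
  refine CycSep.of_hom ((AddMonoidHom.toMultiplicative (Int.castAddHom (ZMod d))).comp f) g h ?_
  intro m hm
  apply hdh
  have h2 := congrArg Multiplicative.toAdd hm
  rw [← map_zpow] at h2
  simp only [MonoidHom.comp_apply, map_zpow] at h2
  change (((f h).toAdd : ℤ) : ZMod d) = m • (((f g).toAdd : ℤ) : ZMod d) at h2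
  rw [(ZMod.intCast_zmod_eq_zero_iff_dvd _ _).2 hdg, smul_zero] at h2
  exact (ZMod.intCast_zmod_eq_zero_iff_dvd _ _).1 h2

/-- the case of nonzero exponent of `g` and residual finiteness at `h` -/
theorem CycSep.of_ker {G : Type*} [Group G] (f : G →* Multiplicative ℤ) (g h : G)
    (hg : (f g).toAdd ≠ 0) (hh : f h = 1) (N : Subgroup G) (hN : N.Normal) (hf : N.FiniteIndex)
    (H : h ∉ N) : CycSep g h := by
  have hfin : Finite (G ⧸ N) := Subgroup.finite_quotient_of_finiteIndex
  set r := orderOf (QuotientGroup.mk' N g) with hr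
  have hr0 : 0 < r := orderOf_pos _
  set d := (f g).toAdd.natAbs * r with hd
  have hd0 : d ≠ 0 := by positivity
  haveI : NeZero d := ⟨hd0⟩
  refine CycSep.of_hom ((QuotientGroup.mk' N).prod
    ((AddMonoidHom.toMultiplicative (Int.castAddHom (ZMod d))).comp f)) g h ?_
  intro m hm
  have h1 := congrArg Prod.fst hm
  have h2 := congrArg (fun x => Multiplicative.toAdd (Prod.snd x)) hm
  change (((f h).toAdd : ℤ) : ZMod d) = m • (((f g).toAdd : ℤ) : ZMod d) at h2
  change QuotientGroup.mk' N h = (QuotientGroup.mk' N g) ^ m at h1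
  rw [hh] at h2
  simp only [toAdd_one, Int.cast_zero, zsmul_eq_mul] at h2
  have h3 : ((m * (f g).toAdd : ℤ) : ZMod d) = 0 := by push_cast; exact h2.symm
  rw [ZMod.intCast_zmod_eq_zero_iff_dvd] at h3
  have h4 : (r : ℤ) ∣ m := by
    rw [hd, ← Int.natAbs_dvd_natAbs, Int.natAbs_mul, Int.natAbs_natCast, mul_comm m.natAbs] at h3
    have := Nat.dvd_of_mul_dvd_mul_left (by positivity) h3
    exact Int.natCast_dvd.2 this
  rw [orderOf_dvd_iff_zpow_eq_one.1 h4] at h1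
  exact H ((QuotientGroup.eq_one_iff _).1 h1)

variable {n : ℕ} (φ : FreeAb n →* FreeAb n) (hφ : Function.Injective φ)

/-- stable letter -/
noncomputable def stab : AscHNN φ hφ := HNNExtension.t

/-- embedding -/
noncomputable def emb : FreeAb n →* AscHNN φ hφ := HNNExtension.of

theorem emb_injective : Function.Injective (emb φ hφ) := HNNExtension.of_injective (ascIso φ hφ)

theorem stab_conj (a : FreeAb n) :
    stab φ hφ * emb φ hφ a * (stab φ hφ)⁻¹ = emb φ hφ (φ a) :=
  (HNNExtension.equiv_eq_conj (φ := ascIso φ hφ) ⟨a, Subgroup.mem_top a⟩).symm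

/-- exponent sum -/
noncomputable def tau : AscHNN φ hφ →* Multiplicative ℤ :=
  HNNExtension.lift 1 (Multiplicative.ofAdd 1) (by intro a; simp)

theorem tau_stab : tau φ hφ (stab φ hφ) = Multiplicative.ofAdd 1 :=
  HNNExtension.lift_t _ _ _

theorem tau_emb (a : FreeAb n) : tau φ hφ (emb φ hφ a) = 1 :=
  HNNExtension.lift_of _ _ _ _

theorem stab_pow_conj (i : ℕ) (a : FreeAb n) :
    ∃ b, stab φ hφ ^ (i : ℤ) * emb φ hφ a * stab φ hφ ^ (-(i : ℤ)) = emb φ hφ b := by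
  induction i with
  | zero => exact ⟨a, by simp⟩
  | succ i ih =>
    obtain ⟨b, hb⟩ := ih
    refine ⟨φ b, ?_⟩
    rw [← stab_conj, ← hb]
    push_cast
    group

theorem normal_form (g : AscHNN φ hφ) : ∃ i0 : ℤ, ∀ i ≥ i0,
    ∃ b, stab φ hφ ^ i * g * stab φ hφ ^ (-(i + (tau φ hφ g).toAdd)) = emb φ hφ b := by
  induction g using HNNExtension.induction_on with
  | of a =>
    refine ⟨0, fun i hi => ?_⟩
    obtain ⟨k, rfl⟩ := Int.eq_ofNat_of_zero_le hi
    obtain ⟨b, hb⟩ := stab_pow_conj φ hφ k a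
    refine ⟨b, ?_⟩
    rw [← hb]
    change _ * emb φ hφ a * stab φ hφ ^ (-(_ + (tau φ hφ (emb φ hφ a)).toAdd)) = _
    rw [tau_emb]
    simp
  | t =>
    refine ⟨0, fun i hi => ⟨1, ?_⟩⟩
    change _ * stab φ hφ * stab φ hφ ^ (-(_ + (tau φ hφ (stab φ hφ)).toAdd)) = _
    rw [tau_stab]
    simp only [toAdd_ofAdd, map_one]
    group
  | mul x y hx hy =>
    obtain ⟨i, hi⟩ := hx
    obtain ⟨j, hj⟩ := hy
    refine ⟨max i (j - (tau φ hφ x).toAdd), fun k hk => ?_⟩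
    obtain ⟨b, hb⟩ := hi k (le_trans (le_max_left _ _) hk)
    obtain ⟨c, hc⟩ := hj (k + (tau φ hφ x).toAdd) (by
      have := le_trans (le_max_right _ _) hk
      omega)
    refine ⟨b * c, ?_⟩
    rw [map_mul (emb φ hφ), ← hb, ← hc, map_mul, toAdd_mul]
    group
  | inv x hx =>
    obtain ⟨i, hi⟩ := hx
    refine ⟨i + (tau φ hφ x).toAdd, fun k hk => ?_⟩
    obtain ⟨b, hb⟩ := hi (k - (tau φ hφ x).toAdd) (by omega)
    refine ⟨b⁻¹, ?_⟩
    rw [map_inv (emb φ hφ), ← hb, map_inv, toAdd_inv]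
    group

theorem normal_form_ker (g : AscHNN φ hφ) (hg : tau φ hφ g = 1) : ∃ i0 : ℤ, ∀ i ≥ i0,
    ∃ b, stab φ hφ ^ i * g * (stab φ hφ ^ i)⁻¹ = emb φ hφ b := by
  obtain ⟨i0, h⟩ := normal_form φ hφ g
  refine ⟨i0, fun i hi => ?_⟩
  obtain ⟨b, hb⟩ := h i hi
  refine ⟨b, ?_⟩
  rw [← hb, hg]
  simp

theorem exists_mat (φ : FreeAb n →* FreeAb n) (hφ : Function.Injective φ) : ∃ M : Matrix (Fin n) (Fin n) ℤ,
    M.det ≠ 0 ∧ ∀ a : FreeAb n, (φ a).toAdd = M.mulVec a.toAdd := by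
  let L : (Fin n → ℤ) →ₗ[ℤ] (Fin n → ℤ) := (MonoidHom.toAdditive φ : _ →+ _).toIntLinearMap
  have hL : ∀ a : FreeAb n, (φ a).toAdd = (LinearMap.toMatrix' L).mulVec a.toAdd := by
    intro a
    rw [LinearMap.toMatrix'_mulVec]
    rfl
  refine ⟨LinearMap.toMatrix' L, ?_, hL⟩
  intro h0
  obtain ⟨v, hv, hv0⟩ := Matrix.exists_mulVec_eq_zero_iff.2 h0
  apply hv
  have h1 := hL (Multiplicative.ofAdd v)
  rw [toAdd_ofAdd, hv0] at h1
  have h2 : φ (Multiplicative.ofAdd v) = φ 1 := by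
    rw [map_one]; exact Multiplicative.toAdd.injective h1
  exact congrArg Multiplicative.toAdd (hφ h2)

/-- translation action mod `p` -/
def transl (n p : ℕ) : FreeAb n →* Equiv.Perm (Fin n → ZMod p) where
  toFun a := Equiv.addLeft (fun i => ((a.toAdd i : ℤ) : ZMod p))
  map_one' := by ext x i; simp
  map_mul' a b := by ext x i; simp [add_assoc]

theorem sep_indep (a b : FreeAb n) (i j : Fin n)
    (hij : a.toAdd i * b.toAdd j ≠ a.toAdd j * b.toAdd i) :
    CycSep (emb φ hφ a) (emb φ hφ b) := by
  obtain ⟨M, hM, hMφ⟩ := exists_mat φ hφ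
  set D : ℤ := a.toAdd i * b.toAdd j - a.toAdd j * b.toAdd i with hD
  have hD0 : D ≠ 0 := sub_ne_zero.2 hij
  obtain ⟨p, hp, hpp⟩ := Nat.exists_infinite_primes (M.det.natAbs + D.natAbs + 1)
  haveI : Fact p.Prime := ⟨hpp⟩
  have key : ∀ z : ℤ, z ≠ 0 → z.natAbs < p → ((z : ℤ) : ZMod p) ≠ 0 := by
    intro z hz hzp h
    rw [ZMod.intCast_zmod_eq_zero_iff_dvd, Int.natCast_dvd] at h
    have := Nat.le_of_dvd (by omega) h
    omega
  let M' : Matrix (Fin n) (Fin n) (ZMod p) := (Int.castRingHom (ZMod p)).mapMatrix M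
  have hM' : Function.Injective M'.mulVec := by
    rw [Matrix.mulVec_injective_iff_isUnit, Matrix.isUnit_iff_isUnit_det, isUnit_iff_ne_zero,
      ← RingHom.map_det]
    exact key _ hM (by omega)
  let x : Equiv.Perm (Fin n → ZMod p) :=
    Equiv.ofBijective _ (Finite.injective_iff_bijective.1 hM')
  let f : AscHNN φ hφ →* Equiv.Perm (Fin n → ZMod p) := HNNExtension.lift (transl n p) x (by
    rintro ⟨c, hc⟩
    ext v k
    change M'.mulVec ((fun i => ((c.toAdd i : ℤ) : ZMod p)) + v) k =
      (((φ c).toAdd k : ℤ) : ZMod p) + M'.mulVec v k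
    rw [Matrix.mulVec_add, hMφ, Pi.add_apply]
    congr 1
    simp [M', Matrix.mulVec, dotProduct])
  have hf : ∀ c, f (emb φ hφ c) = transl n p c := fun c => HNNExtension.lift_of _ _ _ _
  refine CycSep.of_hom f _ _ ?_
  intro m hm
  rw [hf, hf, ← map_zpow] at hm
  have h1 : ∀ k, ((b.toAdd k : ℤ) : ZMod p) = m * ((a.toAdd k : ℤ) : ZMod p) := by
    intro k
    have := congrFun (congrArg (fun e : Equiv.Perm (Fin n → ZMod p) => e 0) hm) k
    simpa [transl] using this
  apply key D hD0 (by omega)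
  rw [hD]
  push_cast
  rw [h1 i, h1 j]
  ring

theorem exists_common (a b : FreeAb n)
    (hij : ∀ i j, a.toAdd i * b.toAdd j = a.toAdd j * b.toAdd i) :
    ∃ (c : FreeAb n) (k l : ℤ), a = c ^ k ∧ b = c ^ l := by
  by_cases ha : a = 1
  · exact ⟨b, 0, 1, by simpa using ha, by simp⟩
  obtain ⟨i, hi⟩ : ∃ i, a.toAdd i ≠ 0 := by
    by_contra! h
    exact ha (Multiplicative.toAdd.injective (funext h))
  let S : Subgroup (FreeAb n) :=
    { carrier := {x | ∀ j, a.toAdd i * x.toAdd j = a.toAdd j * x.toAdd i}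
      one_mem' := by intro j; simp
      mul_mem' := by
        intro x y hx hy j
        have h1 := hx j
        have h2 := hy j
        simp only [toAdd_mul, Pi.add_apply]
        linear_combination h1 + h2
      inv_mem' := by
        intro x hx j
        have h1 := hx j
        simp only [toAdd_inv, Pi.neg_apply]
        linear_combination -h1 }
  let pr : S →* Multiplicative ℤ :=
    (AddMonoidHom.toMultiplicative (Pi.evalAddMonoidHom (fun _ : Fin n => ℤ) i)).comp S.subtype
  have hpr : Function.Injective pr := by
    rw [injective_iff_map_eq_one]
    rintro ⟨x, hx⟩ h
    have h0 : x.toAdd i = 0 := h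
    apply Subtype.ext
    apply Multiplicative.toAdd.injective
    funext j
    have := hx j
    rw [h0, mul_zero] at this
    exact (mul_eq_zero.1 this).resolve_left hi
  haveI : IsCyclic S := isCyclic_of_injective pr hpr
  obtain ⟨c, hc⟩ := IsCyclic.exists_generator (α := S)
  obtain ⟨k, hk⟩ := hc ⟨a, fun j => mul_comm _ _⟩
  obtain ⟨l, hl⟩ := hc ⟨b, fun j => hij i j⟩
  exact ⟨c, k, l, (congrArg Subtype.val hk).symm, (congrArg Subtype.val hl).symm⟩

end Helpers

/-- `G = A∗_φ` is cyclic subgroup separable iff for every nontrivial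
`a ∈ A`, every prime `p` and every `s ≥ 1` there is a finite-index normal subgroup
`Gbar` of `G` such that the order of the image of `a` in `G/Gbar` is a multiple of
`p^s`. -/
theorem stmt_10 (n : ℕ) (hn : 1 ≤ n)
    (φ : FreeAb n →* FreeAb n) (hφ : Function.Injective φ) :
    (∀ g h : AscHNN φ hφ, h ∉ Subgroup.zpowers g →
        ∃ N : Subgroup (AscHNN φ hφ), N.Normal ∧ N.FiniteIndex ∧
          h ∉ ((Subgroup.zpowers g : Set (AscHNN φ hφ)) * (N : Set (AscHNN φ hφ)))) ↔
      (∀ a : FreeAb n, a ≠ 1 → ∀ p : ℕ, p.Prime → ∀ s : ℕ, 1 ≤ s →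
        ∃ Gbar : Subgroup (AscHNN φ hφ), ∃ hnorm : Gbar.Normal, Gbar.FiniteIndex ∧
          p ^ s ∣ (letI := hnorm;
            orderOf (QuotientGroup.mk (HNNExtension.of a : AscHNN φ hφ) :
              AscHNN φ hφ ⧸ Gbar))) := by
  constructor
  · intro H a ha p hp s hs
    obtain ⟨i, hi⟩ : ∃ i, a.toAdd i ≠ 0 := by
      by_contra! h
      exact ha (Multiplicative.toAdd.injective (funext h))
    have hnot : emb φ hφ a ^ (p ^ (s - 1)) ∉ Subgroup.zpowers (emb φ hφ a ^ (p ^ s)) := by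
      rintro ⟨m, hm⟩
      have hm' : emb φ hφ ((a ^ (p ^ s)) ^ m) = emb φ hφ (a ^ (p ^ (s - 1))) := by
        simpa using hm
      have h1 := congrFun (congrArg Multiplicative.toAdd (emb_injective φ hφ hm')) i
      simp only [toAdd_zpow, toAdd_pow, Pi.smul_apply, smul_eq_mul, nsmul_eq_mul] at h1
      have h2 : m * ((p ^ s : ℕ) : ℤ) = ((p ^ (s - 1) : ℕ) : ℤ) := by
        apply mul_right_cancel₀ hi
        rw [← h1]
        simp
        ring
      have h3 : p ^ s ∣ p ^ (s - 1) := Int.natCast_dvd_natCast.1 ⟨m, by rw [← h2]; ring⟩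
      have := (Nat.pow_dvd_pow_iff_le_right hp.one_lt).1 h3
      omega
    obtain ⟨N, hN, hfin, hsep⟩ := H _ _ hnot
    refine ⟨N, hN, hfin, ?_⟩
    rw [not_mem_mul_iff] at hsep
    change p ^ s ∣ orderOf (QuotientGroup.mk' N (emb φ hφ a))
    set q := QuotientGroup.mk' N (emb φ hφ a) with hq
    by_contra hnd
    obtain ⟨j, hj, hgcd⟩ := (Nat.dvd_prime_pow hp).1 (Nat.gcd_dvd_left (p ^ s) (orderOf q))
    have hjs : j ≠ s := by
      rintro rfl
      exact hnd (hgcd ▸ Nat.gcd_dvd_right _ _)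
    obtain ⟨w, hw⟩ : p ^ j ∣ p ^ (s - 1) := pow_dvd_pow _ (by omega)
    have hb := Nat.gcd_eq_gcd_ab (p ^ s) (orderOf q)
    rw [hgcd] at hb
    apply hsep (Nat.gcdA (p ^ s) (orderOf q) * w)
    rw [← QuotientGroup.eq_one_iff]
    change QuotientGroup.mk' N _ = 1
    rw [map_mul, map_inv, map_zpow, map_pow, map_pow, inv_mul_eq_one, ← hq,
      ← zpow_natCast, ← zpow_natCast, ← zpow_mul, zpow_eq_zpow_iff_modEq, Int.modEq_iff_dvd]
    refine ⟨Nat.gcdB (p ^ s) (orderOf q) * w, ?_⟩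
    rw [hw, Nat.cast_mul, hb]
    ring
  · intro H g h hgh
    change CycSep g h
    by_cases hdvd : (tau φ hφ g).toAdd ∣ (tau φ hφ h).toAdd
    swap
    · exact CycSep.of_int (tau φ hφ) g h hdvd
    obtain ⟨k, hk⟩ := hdvd
    by_cases hg0 : (tau φ hφ g).toAdd = 0
    · have hg1 : tau φ hφ g = 1 := hg0
      have hh1 : tau φ hφ h = 1 := by
        rw [hg0, zero_mul] at hk; exact hk
      obtain ⟨i, hi⟩ := normal_form_ker φ hφ g hg1
      obtain ⟨j, hj⟩ := normal_form_ker φ hφ h hh1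
      obtain ⟨a, ha⟩ := hi (max i j) (le_max_left _ _)
      obtain ⟨b, hb⟩ := hj (max i j) (le_max_right _ _)
      apply CycSep.of_conj (stab φ hφ ^ (max i j))
      have hab : ∀ m : ℤ, b ≠ a ^ m := by
        rintro m rfl
        apply hgh
        refine ⟨m, ?_⟩
        rw [map_zpow, ← ha, conj_zpow] at hb
        exact (mul_left_cancel (mul_right_cancel hb)).symm
      rw [ha, hb]
      by_cases hij : ∀ i j, a.toAdd i * b.toAdd j = a.toAdd j * b.toAdd i
      swap
      · push Not at hij
        obtain ⟨i, j, hij⟩ := hij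
        exact sep_indep φ hφ a b i j hij
      obtain ⟨c, k, l, rfl, rfl⟩ := exists_common a b hij
      have hkl : ¬ k ∣ l := by
        rintro ⟨m, rfl⟩
        exact hab m (zpow_mul _ _ _)
      have hc : c ≠ 1 := by
        rintro rfl
        exact hab 0 (by simp)
      rw [← Int.natAbs_dvd_natAbs, Nat.dvd_iff_prime_pow_dvd_dvd] at hkl
      push Not at hkl
      obtain ⟨p, s, hp, hps, hpl⟩ := hkl
      have hs : 1 ≤ s := by
        rcases s with _ | s
        · simp at hpl
        · omega
      obtain ⟨N, hN, hfin, hord⟩ := H c hc p hp s hs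
      change p ^ s ∣ orderOf (QuotientGroup.mk' N (emb φ hφ c)) at hord
      refine ⟨N, hN, hfin, ?_⟩
      rw [not_mem_mul_iff]
      intro m hm
      rw [← QuotientGroup.eq_one_iff] at hm
      change QuotientGroup.mk' N _ = 1 at hm
      rw [map_mul, map_inv, map_zpow, map_zpow, map_zpow, map_zpow, map_zpow, inv_mul_eq_one, ← zpow_mul,
        zpow_eq_zpow_iff_modEq, Int.modEq_iff_dvd] at hm
      have h1 : ((p ^ s : ℕ) : ℤ) ∣ l - k * m := (Int.natCast_dvd_natCast.2 hord).trans hm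
      have h2 : ((p ^ s : ℕ) : ℤ) ∣ k := Int.natCast_dvd.2 hps
      apply hpl
      rw [← Int.natCast_dvd]
      simpa using dvd_add h1 (h2.mul_right m)
    · apply CycSep.of_mul_zpow g h (-k)
      set h' := g ^ (-k) * h with hh'
      have hh1 : tau φ hφ h' = 1 := by
        apply Multiplicative.toAdd.injective
        rw [hh', map_mul, map_zpow, toAdd_mul, toAdd_zpow, hk, toAdd_one, smul_eq_mul]
        ring
      have hne : h' ≠ 1 := by
        intro h0
        apply hgh
        refine ⟨k, ?_⟩
        rw [hh', zpow_neg, inv_mul_eq_one] at h0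
        exact h0
      obtain ⟨i, hi⟩ := normal_form_ker φ hφ h' hh1
      obtain ⟨a, ha⟩ := hi i le_rfl
      have ha1 : a ≠ 1 := by
        rintro rfl
        apply hne
        rw [map_one, conj_eq_one_iff] at ha
        exact ha
      obtain ⟨N, hN, hfin, hord⟩ := H a ha1 2 Nat.prime_two 1 le_rfl
      change 2 ^ 1 ∣ orderOf (QuotientGroup.mk' N (emb φ hφ a)) at hord
      refine CycSep.of_ker (tau φ hφ) g h' hg0 hh1 N hN hfin ?_
      intro hmem
      have h1 := hN.conj_mem _ hmem (stab φ hφ ^ i)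
      rw [ha] at h1
      have h2 : QuotientGroup.mk' N (emb φ hφ a) = 1 := (QuotientGroup.eq_one_iff _).2 h1
      rw [h2, orderOf_one] at hord
      omega
end

section
/- Let f_φ ∈ ℤ[X] be the characteristic polynomial of φ (computed with respect to any basis of A ≅ ℤⁿ). Then G is cyclic subgroup separable if and only if there is no prime p and no monic polynomial g ∈ ℤ[X] such that g is irreducible over ℚ, g divides f_φ in ℤ[X], and g ≡ X^{deg g} (mod p) (i.e. the image of g in (ℤ/pℤ)[X] equals X^{deg g}). -/
open Subgroup Pointwise

namespace CSS
open Polynomial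

variable {n : ℕ}

/-- `v ∈ m ℤⁿ`. -/
def Dv (m : ℤ) (v : Fin n → ℤ) : Prop := ∀ i, m ∣ v i

lemma Dv.add {m : ℤ} {v w : Fin n → ℤ} (hv : Dv m v) (hw : Dv m w) : Dv m (v + w) :=
  fun i => dvd_add (hv i) (hw i)

lemma Dv.smul {m : ℤ} {v : Fin n → ℤ} (c : ℤ) (hv : Dv m v) : Dv m (c • v) :=
  fun i => by simpa using Dvd.dvd.mul_left (hv i) c

lemma dv_iff {m : ℤ} {v : Fin n → ℤ} : Dv m v ↔ ∃ w, v = m • w := by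
  constructor
  · intro h
    choose w hw using h
    exact ⟨w, funext fun i => by simp [hw i]⟩
  · rintro ⟨w, rfl⟩ i
    simp

lemma Dv.map {m : ℤ} {v : Fin n → ℤ} (hv : Dv m v) (ψ : (Fin n → ℤ) →ₗ[ℤ] (Fin n → ℤ)) :
    Dv m (ψ v) := by
  obtain ⟨w, rfl⟩ := dv_iff.1 hv
  exact dv_iff.2 ⟨ψ w, map_smul ψ m w⟩

lemma Dv.map_pow_le {m : ℤ} {v : Fin n → ℤ} (ψ : Module.End ℤ (Fin n → ℤ)) {a b : ℕ}
    (hab : a ≤ b) (hv : Dv m ((ψ ^ a) v)) : Dv m ((ψ ^ b) v) := by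
  obtain ⟨c, rfl⟩ := Nat.exists_eq_add_of_le' hab
  rw [pow_add, Module.End.mul_apply]
  exact hv.map _

lemma Dv.of_coprime {m c : ℤ} {v : Fin n → ℤ} (h : IsCoprime m c) (hv : Dv m (c • v)) :
    Dv m v := fun i => by
  have := hv i
  simp only [Pi.smul_apply, smul_eq_mul] at this
  exact h.dvd_of_dvd_mul_left this

/-- two integer monic polynomials that kill a common nonzero vector share a factor -/
lemma exists_common (ψ : Module.End ℤ (Fin n → ℤ)) (u : Fin n → ℤ) (hu : u ≠ 0)
    (f Q : ℤ[X]) (hf : f.Monic) (hfu : aeval ψ f u = 0) (hQu : aeval ψ Q u = 0) :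
    ∃ g : ℤ[X], g.Monic ∧ Irreducible (g.map (Int.castRingHom ℚ)) ∧ g ∣ f ∧ g ∣ Q := by
  have hnc : ¬ IsCoprime (f.map (Int.castRingHom ℚ)) (Q.map (Int.castRingHom ℚ)) := by
    rintro ⟨a, b, hab⟩
    obtain ⟨α, hα, hα'⟩ := IsLocalization.integerNormalization_spec (nonZeroDivisors ℤ) a
    obtain ⟨β, hβ, hβ'⟩ := IsLocalization.integerNormalization_spec (nonZeroDivisors ℤ) b
    set a' := IsLocalization.integerNormalization (nonZeroDivisors ℤ) a
    set b' := IsLocalization.integerNormalization (nonZeroDivisors ℤ) b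
    have hα0 : α ≠ 0 := nonZeroDivisors.ne_zero hα
    have hβ0 : β ≠ 0 := nonZeroDivisors.ne_zero hβ
    have key : C β * a' * f + C α * b' * Q = C (α * β) := by
      apply Polynomial.map_injective (Int.castRingHom ℚ) Int.cast_injective
      have e1 : a'.map (Int.castRingHom ℚ) = C (α : ℚ) * a := by
        rw [← smul_eq_C_mul, ← Int.cast_smul_eq_zsmul ℚ] at *; exact hα'
      have e2 : b'.map (Int.castRingHom ℚ) = C (β : ℚ) * b := by
        rw [← smul_eq_C_mul, ← Int.cast_smul_eq_zsmul ℚ] at *; exact hβ'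
      simp only [Polynomial.map_add, Polynomial.map_mul, e1, e2]
      have hC : ∀ c : ℤ, (C c : ℤ[X]).map (Int.castRingHom ℚ) = C (c : ℚ) := fun c => by
        rw [Polynomial.map_C]; rfl
      rw [hC, hC, hC, Int.cast_mul, C_mul]
      have : (C (α:ℚ) * C (β:ℚ)) * (a * f.map (Int.castRingHom ℚ) + b * Q.map (Int.castRingHom ℚ))
        = C (α:ℚ) * C (β:ℚ) := by rw [hab, mul_one]
      linear_combination this
    have h2 := congrArg (fun P => aeval ψ P u) key
    simp only [map_add, map_mul, LinearMap.add_apply, Module.End.mul_apply, hfu, hQu, map_zero,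
      add_zero] at h2
    rw [aeval_C, aeval_C, Module.algebraMap_end_apply, Module.algebraMap_end_apply] at h2
    exact (smul_ne_zero hα0 (smul_ne_zero hβ0 hu)) h2.symm
  rw [Polynomial.isCoprime_iff_aeval_ne_zero_of_isAlgClosed (k := ℚ) (K := ℂ)
    (f.map (Int.castRingHom ℚ)) (Q.map (Int.castRingHom ℚ))] at hnc
  push Not at hnc
  obtain ⟨z, hz1, hz2⟩ := hnc
  have hz1' : aeval z f = 0 := by
    rw [← hz1]; exact (aeval_map_algebraMap (A := ℚ) z f).symm
  have hz2' : aeval z Q = 0 := by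
    rw [← hz2]; exact (aeval_map_algebraMap (A := ℚ) z Q).symm
  have hint : IsIntegral ℤ z := ⟨f, hf, by simpa [aeval_def] using hz1'⟩
  refine ⟨minpoly ℤ z, minpoly.monic hint, ?_, minpoly.isIntegrallyClosed_dvd hint hz1',
    minpoly.isIntegrallyClosed_dvd hint hz2'⟩
  have := minpoly.isIntegrallyClosed_eq_field_fractions' ℚ hint
  change Irreducible ((minpoly ℤ z).map (algebraMap ℤ ℚ))
  rw [← this]
  exact minpoly.irreducible hint.tower_top

/-- vectors on which `ψ` is `p`-adically topologically nilpotent -/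
def nilp (ψ : Module.End ℤ (Fin n → ℤ)) (p : ℕ) : Submodule ℤ (Fin n → ℤ) where
  carrier := {w | ∀ k : ℕ, ∃ m : ℕ, Dv ((p : ℤ) ^ k) ((ψ ^ m) w)}
  zero_mem' := fun k => ⟨0, fun i => by simp⟩
  add_mem' := by
    intro a b ha hb k
    obtain ⟨m1, h1⟩ := ha k
    obtain ⟨m2, h2⟩ := hb k
    refine ⟨max m1 m2, ?_⟩
    rw [map_add]
    exact (h1.map_pow_le ψ (le_max_left _ _)).add (h2.map_pow_le ψ (le_max_right _ _))
  smul_mem' := by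
    intro c x hx k
    obtain ⟨m, h⟩ := hx k
    exact ⟨m, by rw [map_smul]; exact h.smul c⟩

lemma mem_nilp {ψ : Module.End ℤ (Fin n → ℤ)} {p : ℕ} {w : Fin n → ℤ} :
    w ∈ nilp ψ p ↔ ∀ k : ℕ, ∃ m : ℕ, Dv ((p : ℤ) ^ k) ((ψ ^ m) w) := Iff.rfl

lemma nilp_pow {ψ : Module.End ℤ (Fin n → ℤ)} {p : ℕ} (M : ℕ) {w : Fin n → ℤ}
    (hw : w ∈ nilp ψ p) : (ψ ^ M) w ∈ nilp ψ p := fun k => by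
  obtain ⟨m, h⟩ := hw k
  refine ⟨m, ?_⟩
  rw [← Module.End.mul_apply, ← pow_add]
  exact h.map_pow_le ψ (by omega)

lemma key (ψ : Module.End ℤ (Fin n → ℤ)) (p : ℕ) (hp : p.Prime) (u : Fin n → ℤ) (hu : u ≠ 0)
    (h : ∀ k : ℕ, ∃ m : ℕ, Dv ((p : ℤ) ^ k) ((ψ ^ m) u)) :
    ∃ g : ℤ[X], g.Monic ∧ Irreducible (g.map (Int.castRingHom ℚ)) ∧
      g ∣ LinearMap.charpoly ψ ∧ g.map (Int.castRingHom (ZMod p)) = X ^ g.natDegree := by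
  have hp0 : (p : ℤ) ≠ 0 := by exact_mod_cast hp.ne_zero
  -- uniform exponent
  obtain ⟨s, hs⟩ := (IsNoetherian.noetherian (nilp ψ p) : (nilp ψ p).FG)
  have hunif : ∃ M : ℕ, ∀ w ∈ nilp ψ p, Dv (p : ℤ) ((ψ ^ M) w) := by
    have h1 : ∀ x : s, ∃ m : ℕ, Dv (p : ℤ) ((ψ ^ m) (x : Fin n → ℤ)) := fun x => by
      have : (x : Fin n → ℤ) ∈ nilp ψ p := by rw [← hs]; exact Submodule.subset_span x.2
      simpa using this 1
    choose m hm using h1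
    refine ⟨Finset.univ.sup m, fun w hw => ?_⟩
    rw [← hs] at hw
    induction hw using Submodule.span_induction with
    | mem x hx => exact (hm ⟨x, hx⟩).map_pow_le ψ (Finset.le_sup (f := m) (Finset.mem_univ _))
    | zero => intro i; simp
    | add x y _ _ hx hy => rw [map_add]; exact hx.add hy
    | smul c x _ hx => rw [map_smul]; exact hx.smul c
  obtain ⟨M, hM⟩ := hunif
  let T : Module.End ℤ (nilp ψ p) := (ψ ^ M).restrict (fun w hw => nilp_pow M hw)
  have hT : LinearMap.range T ≤ (Ideal.span {(p : ℤ)}) • (⊤ : Submodule ℤ (nilp ψ p)) := by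
    rintro _ ⟨w, rfl⟩
    obtain ⟨v, hv⟩ := dv_iff.1 (hM w.1 w.2)
    have hvm : v ∈ nilp ψ p := fun k => by
      obtain ⟨m, h'⟩ := nilp_pow M w.2 (k + 1)
      refine ⟨m, ?_⟩
      rw [hv, map_smul] at h'
      intro i
      have := h' i
      rw [pow_succ', Pi.smul_apply, smul_eq_mul] at this
      exact Int.dvd_of_mul_dvd_mul_left hp0 this
    have : T w = (p : ℤ) • (⟨v, hvm⟩ : nilp ψ p) := Subtype.ext hv
    rw [this]
    exact Submodule.smul_mem_smul (Ideal.mem_span_singleton_self _) trivial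
  obtain ⟨P, hPm, -, hPc, hP0⟩ :=
    LinearMap.exists_monic_and_natDegree_eq_and_coeff_mem_pow_and_aeval_eq_zero ℤ T _ hT
  have hPmap : P.map (Int.castRingHom (ZMod p)) = X ^ P.natDegree := by
    ext k
    rw [coeff_map, coeff_X_pow]
    split_ifs with hk
    · rw [hk, coeff_natDegree, hPm.leadingCoeff]; simp
    · rcases lt_or_gt_of_ne hk with hk | hk
      · have h1 := Ideal.pow_le_self (by omega) (hPc k)
        rw [Ideal.mem_span_singleton] at h1
        simpa using (ZMod.intCast_zmod_eq_zero_iff_dvd _ _).2 h1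
      · rw [coeff_eq_zero_of_natDegree_lt hk]; simp
  have hres : ∀ (R : ℤ[X]) (w : nilp ψ p), ((aeval T R w : nilp ψ p) : Fin n → ℤ)
      = aeval (ψ ^ M) R (w : Fin n → ℤ) := by
    intro R w
    induction R using Polynomial.induction_on' generalizing w with
    | add a b ha hb => simp [ha, hb]
    | monomial k c =>
      have : ∀ (k : ℕ) (w : nilp ψ p), (((T ^ k) w : nilp ψ p) : Fin n → ℤ)
          = ((ψ ^ M) ^ k) (w : Fin n → ℤ) := by
        intro k
        induction k with
        | zero => intro w; simp
        | succ k ih => intro w; rw [pow_succ, Module.End.mul_apply, ih, pow_succ,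
            Module.End.mul_apply]; rfl
      simp [aeval_monomial, this]
  have hQu : aeval ψ (P.comp (X ^ M)) u = 0 := by
    rw [aeval_comp, map_pow, aeval_X]
    have := hres P ⟨u, h⟩
    rw [hP0] at this
    exact this.symm
  obtain ⟨g, hg1, hg2, hg3, hg4⟩ := exists_common ψ u hu (LinearMap.charpoly ψ) _
    (LinearMap.charpoly_monic ψ) (by rw [LinearMap.aeval_self_charpoly]; rfl) hQu
  refine ⟨g, hg1, hg2, hg3, ?_⟩
  have : Fact p.Prime := ⟨hp⟩
  have hd : g.map (Int.castRingHom (ZMod p)) ∣ X ^ (M * P.natDegree) := by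
    have := Polynomial.map_dvd (Int.castRingHom (ZMod p)) hg4
    rw [Polynomial.map_comp, hPmap] at this
    simpa [pow_mul] using this
  obtain ⟨i, -, hi⟩ := (dvd_prime_pow (prime_X (R := ZMod p)) _).1 hd
  have hmon := hg1.map (Int.castRingHom (ZMod p))
  have e := eq_of_monic_of_associated hmon (monic_X_pow i) hi
  have : g.natDegree = i := by
    rw [← hg1.natDegree_map (Int.castRingHom (ZMod p)), e, natDegree_X_pow]
  rw [e, this]

/-- a factor of the characteristic polynomial kills a nonzero vector -/
lemma exists_killed (ψ : Module.End ℤ (Fin n → ℤ)) (g : ℤ[X])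
    (hirr : Irreducible (g.map (Int.castRingHom ℚ))) (hd : g ∣ LinearMap.charpoly ψ) :
    ∃ a : Fin n → ℤ, a ≠ 0 ∧ aeval ψ g a = 0 := by
  set A : Matrix (Fin n) (Fin n) ℤ := LinearMap.toMatrix' ψ with hA
  have hch : A.charpoly = LinearMap.charpoly ψ := by
    rw [hA, ← LinearMap.charpoly_toMatrix ψ (Pi.basisFun ℤ (Fin n))]; rfl
  obtain ⟨z, hz⟩ := IsAlgClosed.exists_aeval_eq_zero ℂ (g.map (Int.castRingHom ℚ))
    (degree_pos_of_irreducible hirr).ne'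
  have hz' : (g.map (Int.castRingHom ℂ)).IsRoot z := by
    rw [aeval_def, eval₂_map] at hz
    rw [IsRoot, eval_map, ← hz]; congr 1
  set B := A.map (Int.castRingHom ℂ) with hB
  have hzB : B.charpoly.IsRoot z := by
    rw [hB, Matrix.charpoly_map, hch]
    exact hz'.dvd (Polynomial.map_dvd _ hd)
  have hdet : (aeval A g).det = 0 := by
    apply (Int.cast_injective (α := ℂ))
    have e1 : ((aeval A g).det : ℂ) = ((aeval A g).map (Int.castRingHom ℂ)).det := by
      exact RingHom.map_det (Int.castRingHom ℂ) _
    have e2 : (aeval A g).map (Int.castRingHom ℂ) = aeval B (g.map (Int.castRingHom ℂ)) := by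
      rw [aeval_def, aeval_def, eval₂_map]
      change (Int.castRingHom ℂ).mapMatrix _ = _
      rw [hom_eval₂]
      congr 1
      exact RingHom.ext_int _ _
    obtain ⟨q, hq⟩ := dvd_iff_isRoot.2 hz'
    rw [e1, e2, hq, map_mul, Matrix.det_mul]
    have : (aeval B (X - C z)).det = 0 := by
      have h0 : B.charpoly.eval z = 0 := hzB
      rw [Matrix.eval_charpoly] at h0
      rw [map_sub, aeval_X, aeval_C, ← neg_sub, Matrix.det_neg]
      have : algebraMap ℂ (Matrix (Fin n) (Fin n) ℂ) z = Matrix.scalar (Fin n) z := rfl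
      rw [this, h0, mul_zero]
    rw [this]; simp
  obtain ⟨v, hv, hv0⟩ := Matrix.exists_mulVec_eq_zero_iff.2 hdet
  refine ⟨v, hv, ?_⟩
  have : aeval ψ g = Matrix.toLin' (aeval A g) := by
    have h1 : ψ = Matrix.toLinAlgEquiv' A := (Matrix.toLin'_toMatrix' ψ).symm
    conv_lhs => rw [h1]
    exact Polynomial.aeval_algHom_apply (Matrix.toLinAlgEquiv' : Matrix (Fin n) (Fin n) ℤ ≃ₐ[ℤ] _) A g
  rw [this, Matrix.toLin'_apply, hv0]

/-- a large prime that does not divide the determinant -/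
lemma det_cancel (ψ : Module.End ℤ (Fin n → ℤ)) (m : ℤ) (hm : IsCoprime m (LinearMap.det ψ))
    (s : ℕ) (v : Fin n → ℤ) (h : Dv m ((ψ ^ s) v)) : Dv m v := by
  induction s with
  | zero => simpa using h
  | succ s ih =>
    apply ih
    rw [pow_succ', Module.End.mul_apply] at h
    set w := (ψ ^ s) v
    set A : Matrix (Fin n) (Fin n) ℤ := LinearMap.toMatrix' ψ with hA
    have h1 : ψ w = A.mulVec w := by rw [hA, LinearMap.toMatrix'_mulVec]
    have h2 := h.map (Matrix.toLin' A.adjugate)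
    rw [h1, Matrix.toLin'_apply, Matrix.mulVec_mulVec, Matrix.adjugate_mul, Matrix.smul_mulVec,
      Matrix.one_mulVec] at h2
    refine Dv.of_coprime ?_ h2
    rwa [hA, LinearMap.det_toMatrix']

lemma det_ne (ψ : Module.End ℤ (Fin n → ℤ)) (h : Function.Injective ψ) : LinearMap.det ψ ≠ 0 := by
  rw [← LinearMap.det_toMatrix']
  intro h0
  obtain ⟨v, hv, hv0⟩ := Matrix.exists_mulVec_eq_zero_iff.2 h0
  rw [LinearMap.toMatrix'_mulVec] at hv0
  exact hv (h (by rw [hv0, map_zero]))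

lemma exists_prime (d e : ℤ) (hd : d ≠ 0) (he : e ≠ 0) :
    ∃ p : ℕ, p.Prime ∧ IsCoprime (p : ℤ) d ∧ ¬ (p : ℤ) ∣ e := by
  obtain ⟨p, hp1, hp⟩ := Nat.exists_infinite_primes (d.natAbs + e.natAbs + 1)
  refine ⟨p, hp, ?_, ?_⟩
  · rw [(Nat.prime_iff_prime_int.1 hp).coprime_iff_not_dvd]
    intro h
    have := Nat.le_of_dvd (Int.natAbs_pos.2 hd) (Int.natCast_dvd.1 h)
    omega
  · intro h
    have := Nat.le_of_dvd (Int.natAbs_pos.2 he) (Int.natCast_dvd.1 h)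
    omega

end CSS
namespace CSS
open Polynomial

variable {n : ℕ} {ψ : Module.End ℤ (Fin n → ℤ)} {φ : FreeAb n →* FreeAb n}
  {hφ : Function.Injective φ}

/-- base group embedding, additive source -/
noncomputable def emb (φ : FreeAb n →* FreeAb n) (hφ : Function.Injective φ) (a : Fin n → ℤ) :
    AscHNN φ hφ := HNNExtension.of (Multiplicative.ofAdd a)

/-- stable letter -/
noncomputable def st (φ : FreeAb n →* FreeAb n) (hφ : Function.Injective φ) :
    AscHNN φ hφ := HNNExtension.t

lemma emb_add (a b : Fin n → ℤ) : emb φ hφ (a + b) = emb φ hφ a * emb φ hφ b := by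
  simp [emb]

lemma emb_zero : emb φ hφ 0 = 1 := by
  simp [emb]

lemma emb_neg (a : Fin n → ℤ) : emb φ hφ (-a) = (emb φ hφ a)⁻¹ := by
  simp [emb]

lemma emb_zsmul (j : ℤ) (a : Fin n → ℤ) : emb φ hφ (j • a) = (emb φ hφ a) ^ j := by
  rw [emb, ofAdd_zsmul, map_zpow, emb]

lemma emb_inj : Function.Injective (emb φ hφ) := fun a b h =>
  Multiplicative.ofAdd.injective (HNNExtension.of_injective _ h)

lemma st_emb (hφψ : ∀ a : Fin n → ℤ, φ (Multiplicative.ofAdd a) = Multiplicative.ofAdd (ψ a))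
    (a : Fin n → ℤ) : st φ hφ * emb φ hφ a = emb φ hφ (ψ a) * st φ hφ := by
  have := HNNExtension.t_mul_of (φ := ascIso φ hφ)
    (⟨Multiplicative.ofAdd a, trivial⟩ : (⊤ : Subgroup (FreeAb n)))
  rw [emb, emb, ← hφψ]
  exact this

lemma st_pow_emb (hφψ : ∀ a : Fin n → ℤ, φ (Multiplicative.ofAdd a) = Multiplicative.ofAdd (ψ a))
    (j : ℕ) (a : Fin n → ℤ) :
    (st φ hφ) ^ j * emb φ hφ a = emb φ hφ ((ψ ^ j) a) * (st φ hφ) ^ j := by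
  induction j with
  | zero => simp
  | succ j ih =>
    rw [pow_succ', mul_assoc, ih, ← mul_assoc, st_emb hφψ, mul_assoc, pow_succ' ψ,
      Module.End.mul_apply]

/-- the exponent of the stable letter -/
noncomputable def ep (φ : FreeAb n →* FreeAb n) (hφ : Function.Injective φ) :
    AscHNN φ hφ →* Multiplicative ℤ :=
  HNNExtension.lift 1 (Multiplicative.ofAdd 1) (by simp)

/-- additive exponent -/
noncomputable def ex (g : AscHNN φ hφ) : ℤ := Multiplicative.toAdd (ep φ hφ g)

lemma ex_mul (g h : AscHNN φ hφ) : ex (g * h) = ex g + ex h := by simp [ex]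
lemma ex_inv (g : AscHNN φ hφ) : ex (g⁻¹) = - ex g := by simp [ex]
lemma ex_zpow (g : AscHNN φ hφ) (j : ℤ) : ex (g ^ j) = j * ex g := by simp [ex]
lemma ex_emb (a : Fin n → ℤ) : ex (emb φ hφ a) = 0 := by simp [ex, emb, ep]
lemma ex_st : ex (st φ hφ) = 1 := by simp [ex, st, ep]

lemma form_raise
    (hφψ : ∀ a : Fin n → ℤ, φ (Multiplicative.ofAdd a) = Multiplicative.ofAdd (ψ a))
    {g : AscHNN φ hφ} {m : ℕ} {a : Fin n → ℤ} {k : ℤ}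
    (h : (st φ hφ) ^ m * g = emb φ hφ a * (st φ hφ) ^ ((m : ℤ) + k)) (j : ℕ) :
    (st φ hφ) ^ (j + m) * g = emb φ hφ ((ψ ^ j) a) * (st φ hφ) ^ (((j + m : ℕ) : ℤ) + k) := by
  rw [pow_add, mul_assoc, h, ← mul_assoc, st_pow_emb hφψ, mul_assoc, ← zpow_natCast, ← zpow_add]
  push_cast
  rw [add_assoc]

lemma form
    (hφψ : ∀ a : Fin n → ℤ, φ (Multiplicative.ofAdd a) = Multiplicative.ofAdd (ψ a))
    (g : AscHNN φ hφ) : ∃ (m : ℕ) (a : Fin n → ℤ),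
      (st φ hφ) ^ m * g = emb φ hφ a * (st φ hφ) ^ ((m : ℤ) + ex g) := by
  induction g using HNNExtension.induction_on with
  | of g =>
    refine ⟨0, Multiplicative.toAdd g, ?_⟩
    have : ex (HNNExtension.of g : AscHNN φ hφ) = 0 := ex_emb (Multiplicative.toAdd g)
    rw [this]
    simp [emb]
  | t =>
    refine ⟨0, 0, ?_⟩
    have : ex (HNNExtension.t : AscHNN φ hφ) = 1 := ex_st
    rw [this]
    simp [emb_zero, st]
  | mul g h hg hh =>
    obtain ⟨m, a, h1⟩ := hg
    obtain ⟨m', a', h2⟩ := hh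
    have h1 := form_raise hφψ h1 (m' + (ex g).natAbs)
    set M := m' + (ex g).natAbs + m with hM
    obtain ⟨j, hj⟩ : ∃ j : ℕ, (M : ℤ) + ex g = j + m' :=
      ⟨((M : ℤ) + ex g - m').toNat, by omega⟩
    refine ⟨M, (ψ ^ (m' + (ex g).natAbs)) a + (ψ ^ j) a', ?_⟩
    rw [← mul_assoc, h1, hj, zpow_add, zpow_natCast, zpow_natCast, mul_assoc, mul_assoc, h2,
      ← mul_assoc (_ ^ j), st_pow_emb hφψ, mul_assoc, ← zpow_natCast, ← zpow_add, ← mul_assoc,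
      ← emb_add, ex_mul]
    congr 2
    omega
  | inv g hg =>
    obtain ⟨m, a, h1⟩ := hg
    have h1 := form_raise hφψ h1 (ex g).natAbs
    set M := (ex g).natAbs + m with hM
    obtain ⟨j, hj⟩ : ∃ j : ℕ, (M : ℤ) + ex g = j :=
      ⟨((M : ℤ) + ex g).toNat, by omega⟩
    refine ⟨j, -(ψ ^ (ex g).natAbs) a, ?_⟩
    rw [ex_inv, ← hj]
    have e : (M : ℤ) + ex g + - ex g = M := by omega
    rw [e, emb_neg, zpow_natCast, mul_inv_eq_iff_eq_mul, mul_assoc, h1, hj, zpow_natCast]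
    simp

/-- elements with exponent zero are conjugate into the base -/
lemma conj_base
    (hφψ : ∀ a : Fin n → ℤ, φ (Multiplicative.ofAdd a) = Multiplicative.ofAdd (ψ a))
    (g : AscHNN φ hφ) (h : ex g = 0) : ∃ m : ℕ, ∀ j : ℕ, ∃ a : Fin n → ℤ,
      (st φ hφ) ^ (j + m) * g * ((st φ hφ) ^ (j + m))⁻¹ = emb φ hφ a := by
  obtain ⟨m, a, h1⟩ := form hφψ g
  refine ⟨m, fun j => ⟨(ψ ^ j) a, ?_⟩⟩
  have := form_raise hφψ h1 j
  rw [h, add_zero, zpow_natCast] at this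
  rw [this]; simp

lemma exists_idem {X : Type*} [Monoid X] [Finite X] (f : X) : ∃ s : ℕ, 0 < s ∧ f ^ s * f ^ s = f ^ s := by
  obtain ⟨i, j, hij, h⟩ := Finite.exists_ne_map_eq_of_infinite (fun i : ℕ => f ^ i)
  wlog hlt : i < j generalizing i j
  · exact this j i hij.symm h.symm (by omega)
  obtain ⟨c, rfl⟩ := Nat.exists_eq_add_of_lt hlt
  set d := c + 1
  have h1 : ∀ a, f ^ (i + a) = f ^ (i + a + d) := fun a => by
    rw [pow_add, h, ← pow_add]; congr 1; omega
  have h2 : ∀ k a, f ^ (i + a) = f ^ (i + a + k * d) := fun k => by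
    induction k with
    | zero => simp
    | succ k ih => intro a; rw [ih, add_assoc, h1]; congr 1; ring
  refine ⟨(i + 1) * d, by positivity, ?_⟩
  rw [← pow_add]
  obtain ⟨a, ha⟩ : ∃ a, (i + 1) * d = i + a :=
    Nat.exists_eq_add_of_le (by have : 0 < d := Nat.succ_pos c; nlinarith)
  have := h2 (i + 1) a
  rw [← ha] at this
  exact this.symm

lemma quot
    (hφψ : ∀ a : Fin n → ℤ, φ (Multiplicative.ofAdd a) = Multiplicative.ofAdd (ψ a))
    (m : ℕ) (hm : m ≠ 0) : ∃ N : Subgroup (AscHNN φ hφ), N.Normal ∧ N.FiniteIndex ∧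
      ∃ s : ℕ, ∀ a, emb φ hφ a ∈ N → Dv (m : ℤ) ((ψ ^ s) a) := by
  have : NeZero m := ⟨hm⟩
  let A : Matrix (Fin n) (Fin n) ℤ := LinearMap.toMatrix' ψ
  let f : Module.End (ZMod m) (Fin n → ZMod m) :=
    Matrix.toLin' (A.map (Int.castRingHom (ZMod m)))
  let red : (Fin n → ℤ) →+ (Fin n → ZMod m) := (Int.castAddHom (ZMod m)).compLeft (Fin n)
  have hred : ∀ a, red (ψ a) = f (red a) := fun a => by
    have h1 : ψ a = A.mulVec a := by rw [LinearMap.toMatrix'_mulVec]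
    funext i
    rw [h1]
    exact RingHom.map_mulVec (Int.castRingHom (ZMod m)) A a i
  have hredpow : ∀ (s : ℕ) a, red ((ψ ^ s) a) = (f ^ s) (red a) := fun s => by
    induction s with
    | zero => simp
    | succ s ih => intro a; rw [pow_succ, pow_succ, Module.End.mul_apply, ih, hred,
        Module.End.mul_apply]
  have : Finite (Module.End (ZMod m) (Fin n → ZMod m)) :=
    Finite.of_injective (fun g => (g : (Fin n → ZMod m) → (Fin n → ZMod m))) DFunLike.coe_injective
  obtain ⟨s, hs, hidem⟩ := exists_idem f
  let E : Submodule (ZMod m) (Fin n → ZMod m) := LinearMap.eqLocus (f ^ s) LinearMap.id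
  have hE : ∀ x, x ∈ E ↔ (f ^ s) x = x := fun x => Iff.rfl
  have hEpow : ∀ (k : ℕ) x, x ∈ E → (f ^ k) x ∈ E := fun k x hx => by
    rw [hE] at *
    rw [← Module.End.mul_apply, ← pow_add, add_comm, pow_add, Module.End.mul_apply, hx]
  have hproj : ∀ x, (f ^ s) x ∈ E := fun x => by
    rw [hE, ← Module.End.mul_apply, hidem]
  let θ : (Fin n → ℤ) →+ E := AddMonoidHom.mk' (fun a => ⟨(f ^ s) (red a), hproj _⟩) (by
    intro a b; ext1; simp)
  let τ : Equiv.Perm E :=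
    { toFun := fun e => ⟨f e, by simpa using hEpow 1 e e.2⟩
      invFun := fun e => ⟨(f ^ (s - 1)) e, hEpow _ e e.2⟩
      left_inv := fun e => by
        ext1
        change (f ^ (s - 1)) (f e) = e
        rw [← Module.End.mul_apply, ← pow_succ, Nat.sub_add_cancel hs]
        exact e.2
      right_inv := fun e => by
        ext1
        change f ((f ^ (s - 1)) e) = e
        rw [← Module.End.mul_apply, ← pow_succ', Nat.sub_add_cancel hs]
        exact e.2 }
  let T : FreeAb n →* Equiv.Perm E := AddMonoidHom.toMultiplicativeLeft ((AddAction.toPermHom E E).comp θ)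
  have hT : ∀ a e, T (Multiplicative.ofAdd a) e = θ a + e := fun a e => rfl
  let L : AscHNN φ hφ →* Equiv.Perm E := HNNExtension.lift T τ (by
    rintro ⟨a, -⟩
    have : ((ascIso φ hφ ⟨a, trivial⟩ : φ.range) : FreeAb n) = φ a := rfl
    rw [this]
    obtain ⟨a, rfl⟩ := Multiplicative.ofAdd.surjective a
    rw [hφψ]
    ext1 e
    rw [Equiv.Perm.mul_apply, Equiv.Perm.mul_apply, hT, hT]
    ext1
    change f ((f ^ s) (red a) + e) = (f ^ s) (red (ψ a)) + f e
    rw [map_add, hred, ← Module.End.mul_apply, ← Module.End.mul_apply, ← pow_succ, ← pow_succ'])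
  have : Finite (Equiv.Perm E) := inferInstance
  refine ⟨L.ker, inferInstance, inferInstance, s, fun a ha => ?_⟩
  have h1 : T (Multiplicative.ofAdd a) = 1 := by
    rw [MonoidHom.mem_ker] at ha
    rw [← ha]
    exact (HNNExtension.lift_of _ _ _ _).symm
  have h2 : θ a + 0 = 0 := by rw [← hT, h1]; rfl
  rw [add_zero] at h2
  have h3 : red ((ψ ^ s) a) = 0 := by
    rw [hredpow]; exact congrArg Subtype.val h2
  intro i
  exact (ZMod.intCast_zmod_eq_zero_iff_dvd _ _).1 (congrFun h3 i)

lemma epsN (φ : FreeAb n →* FreeAb n) (hφ : Function.Injective φ) (r : ℤ) (hr : r ≠ 0) :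
    ∃ N : Subgroup (AscHNN φ hφ), N.Normal ∧ N.FiniteIndex ∧ ∀ g ∈ N, r ∣ ex g := by
  have : NeZero r.natAbs := ⟨by simpa using hr⟩
  let F : AscHNN φ hφ →* Multiplicative (ZMod r.natAbs) :=
    (AddMonoidHom.toMultiplicative (Int.castAddHom (ZMod r.natAbs))).comp (ep φ hφ)
  have : Finite (Multiplicative (ZMod r.natAbs)) := inferInstanceAs (Finite (ZMod r.natAbs))
  refine ⟨F.ker, inferInstance, inferInstance, fun g hg => ?_⟩
  have h1 : ((ex g : ℤ) : ZMod r.natAbs) = 0 := hg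
  have := (ZMod.intCast_zmod_eq_zero_iff_dvd _ _).1 h1
  rwa [Int.natAbs_dvd] at this

lemma resid
    (hφψ : ∀ a : Fin n → ℤ, φ (Multiplicative.ofAdd a) = Multiplicative.ofAdd (ψ a))
    (hinj : Function.Injective ψ)
    (δ : ℤ) (hδ : δ ≠ 0) : ∃ N : Subgroup (AscHNN φ hφ), N.Normal ∧ N.FiniteIndex ∧
      ∃ p : ℤ, ¬ p ∣ δ ∧ ∀ a, emb φ hφ a ∈ N → Dv p a := by
  obtain ⟨p, hp, hc, hd⟩ := exists_prime (LinearMap.det ψ) δ (det_ne ψ hinj) hδ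
  obtain ⟨N, h1, h2, s, h3⟩ := quot (hφ := hφ) hφψ p hp.ne_zero
  exact ⟨N, h1, h2, p, hd, fun a ha => det_cancel ψ p hc s a (h3 a ha)⟩

lemma sepB
    (hφψ : ∀ a : Fin n → ℤ, φ (Multiplicative.ofAdd a) = Multiplicative.ofAdd (ψ a))
    (hinj : Function.Injective ψ)
    (hno : ¬ ∃ p : ℕ, p.Prime ∧ ∃ g : Polynomial ℤ, g.Monic ∧
          Irreducible (g.map (Int.castRingHom ℚ)) ∧
          g ∣ LinearMap.charpoly ψ ∧
          g.map (Int.castRingHom (ZMod p)) = Polynomial.X ^ g.natDegree)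
    (β η : Fin n → ℤ) (hne : ∀ j : ℤ, η ≠ j • β) :
    ∃ N : Subgroup (AscHNN φ hφ), N.Normal ∧ N.FiniteIndex ∧
      ∀ j : ℤ, emb φ hφ (η - j • β) ∉ N := by
  by_cases hmin : ∃ i k, η i * β k - η k * β i ≠ 0
  · obtain ⟨i, k, hik⟩ := hmin
    obtain ⟨N, h1, h2, p, hp, h3⟩ := resid (hφ := hφ) hφψ hinj _ hik
    refine ⟨N, h1, h2, fun j hj => hp ?_⟩
    have h4 := h3 _ hj
    have e : η i * β k - η k * β i = (η - j • β) i * β k - (η - j • β) k * β i := by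
      simp only [Pi.sub_apply, Pi.smul_apply, smul_eq_mul]; ring
    rw [e]
    exact dvd_sub ((h4 i).mul_right _) ((h4 k).mul_right _)
  · push Not at hmin
    by_cases hβ : β = 0
    · subst hβ
      have h0 : η ≠ 0 := by simpa using hne 0
      obtain ⟨i, hi⟩ := Function.ne_iff.1 h0
      obtain ⟨N, h1, h2, p, hp, h3⟩ := resid (hφ := hφ) hφψ hinj _ hi
      refine ⟨N, h1, h2, fun j hj => hp ?_⟩
      simpa using h3 _ hj i
    · obtain ⟨i, hi⟩ := Function.ne_iff.1 hβ
      obtain ⟨r, s, hrs, hr, hs⟩ : ∃ r s : ℤ, IsCoprime r s ∧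
          β i = r * (Int.gcd (β i) (η i)) ∧ η i = s * (Int.gcd (β i) (η i)) := by
        obtain ⟨r, s, h, h1, h2⟩ := Int.exists_gcd_one
          (Int.gcd_pos_of_ne_zero_left (η i) hi)
        exact ⟨r, s, Int.isCoprime_iff_gcd_eq_one.2 h, h1, h2⟩
      set d : ℤ := (Int.gcd (β i) (η i) : ℤ)
      have hd0 : d ≠ 0 := fun h => hi (by rw [hr, h]; simp)
      have hrel : ∀ k, r * η k = s * β k := fun k => by
        have := hmin i k
        apply mul_left_cancel₀ hd0
        linear_combination -this + η k * hr * (-1) + hs * β k * 1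
      obtain ⟨x, y, hxy⟩ := hrs
      let u : Fin n → ℤ := x • β + y • η
      have hβu : β = r • u := funext fun k => by
        simp only [u, Pi.add_apply, Pi.smul_apply, smul_eq_mul]
        linear_combination (-β k) * hxy - y * hrel k
      have hηu : η = s • u := funext fun k => by
        simp only [u, Pi.add_apply, Pi.smul_apply, smul_eq_mul]
        linear_combination (-η k) * hxy + x * hrel k
      have hu : u ≠ 0 := fun h => hβ (by rw [hβu, h, smul_zero])
      have hr1 : r.natAbs ≠ 1 := by
        intro h
        have hrr : r * r = 1 := by
          rcases Int.natAbs_eq r with h' | h' <;> rw [h', h] <;> norm_num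
        apply hne (s * r)
        rw [hηu]
        conv_rhs => rw [hβu]
        rw [smul_smul, mul_assoc, hrr, mul_one]
      obtain ⟨p, hp, hpr⟩ := Nat.exists_prime_and_dvd hr1
      have hpr : (p : ℤ) ∣ r := Int.natCast_dvd.2 hpr
      have hk : ∃ k : ℕ, ∀ m : ℕ, ¬ Dv ((p : ℤ) ^ k) ((ψ ^ m) u) := by
        by_contra hcon
        push Not at hcon
        exact hno ⟨p, hp, key ψ p hp u hu hcon⟩
      obtain ⟨k, hk⟩ := hk
      obtain ⟨N, h1, h2, t, h3⟩ := quot (hφ := hφ) hφψ (p ^ k) (pow_ne_zero _ hp.ne_zero)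
      refine ⟨N, h1, h2, fun j hj => hk t ?_⟩
      have h4 := h3 _ hj
      have e : η - j • β = (s - j * r) • u := by
        rw [hηu]
        conv_lhs => rw [hβu]
        rw [sub_smul, mul_smul]
      rw [e, map_smul] at h4
      push_cast at h4
      refine Dv.of_coprime (IsCoprime.pow_left ?_) h4
      rw [(Nat.prime_iff_prime_int.1 hp).coprime_iff_not_dvd]
      intro h5
      have h6 : (p : ℤ) ∣ s := by
        have := dvd_add h5 (hpr.mul_left j)
        simpa using this
      have : (p : ℤ) ∣ 1 := by
        rw [← hxy]; exact dvd_add (hpr.mul_left _) (h6.mul_left _)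
      exact (Nat.prime_iff_prime_int.1 hp).not_isUnit (isUnit_of_dvd_one this)

lemma sep_of
    (hφψ : ∀ a : Fin n → ℤ, φ (Multiplicative.ofAdd a) = Multiplicative.ofAdd (ψ a))
    (hinj : Function.Injective ψ)
    (hno : ¬ ∃ p : ℕ, p.Prime ∧ ∃ g : Polynomial ℤ, g.Monic ∧
          Irreducible (g.map (Int.castRingHom ℚ)) ∧
          g ∣ LinearMap.charpoly ψ ∧
          g.map (Int.castRingHom (ZMod p)) = Polynomial.X ^ g.natDegree)
    (x h : AscHNN φ hφ) (hx : ∀ j : ℤ, x ^ j ≠ h) :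
    ∃ N : Subgroup (AscHNN φ hφ), N.Normal ∧ N.FiniteIndex ∧
      ∀ j : ℤ, ∀ y ∈ N, x ^ j * y ≠ h := by
  by_cases hk : ex x = 0
  · by_cases hl : ex h = 0
    · obtain ⟨m1, h1⟩ := conj_base hφψ x hk
      obtain ⟨m2, h2⟩ := conj_base hφψ h hl
      obtain ⟨β, hβ⟩ := h1 m2
      obtain ⟨η, hη⟩ := h2 m1
      rw [add_comm] at hη
      set w := (st φ hφ) ^ (m2 + m1)
      obtain ⟨N, hN1, hN2, hN3⟩ := sepB (hφ := hφ) hφψ hinj hno β η (by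
        intro j hj
        apply hx j
        rw [hj, emb_zsmul, ← hβ, conj_zpow] at hη
        simpa using hη.symm)
      refine ⟨N, hN1, hN2, fun j y hy hxy => hN3 (-(-j)) ?_⟩
      have e : η - (- -j) • β = (- - -j) • β + η := by rw [neg_smul (- -j), neg_add_eq_sub]
      rw [e, emb_add, emb_zsmul, ← hβ, ← hη, conj_zpow]
      have : w * x ^ (- - -j) * w⁻¹ * (w * h * w⁻¹) = w * y * w⁻¹ := by
        rw [← hxy]; simp [mul_assoc]
      rw [this]
      exact hN1.conj_mem y hy w
    · obtain ⟨N, hN1, hN2, hN3⟩ := epsN φ hφ (2 * ex h) (by omega)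
      refine ⟨N, hN1, hN2, fun j y hy hxy => hl ?_⟩
      have h1 := hN3 y hy
      have h2 : ex h = ex y := by rw [← hxy, ex_mul, ex_zpow, hk]; simp
      rw [← h2] at h1
      obtain ⟨c, hc⟩ := h1
      have h3 : ex h * (2 * c - 1) = 0 := by linear_combination -hc
      rcases mul_eq_zero.1 h3 with h4 | h4
      · exact h4
      · omega
  · by_cases hd : ex x ∣ ex h
    · obtain ⟨j, hj⟩ := hd
      set d := h * x ^ (-j) with hdef
      have hd0 : ex d = 0 := by rw [hdef, ex_mul, ex_zpow, hj]; ring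
      have hd1 : d ≠ 1 := fun h1 => hx j (by
        rw [hdef, zpow_neg, mul_inv_eq_one] at h1; exact h1.symm)
      obtain ⟨m, hm⟩ := conj_base hφψ d hd0
      obtain ⟨δ, hδ⟩ := hm 0
      set w := (st φ hφ) ^ (0 + m)
      have hδ0 : δ ≠ 0 := by
        rintro rfl
        rw [emb_zero, conj_eq_one_iff] at hδ
        exact hd1 hδ
      obtain ⟨i, hi⟩ := Function.ne_iff.1 hδ0
      obtain ⟨N, h1, h2, p, hp, h3⟩ := resid (hφ := hφ) hφψ hinj _ hi
      have hdN : d ∉ N := fun hdN => hp (h3 δ (by rw [← hδ]; exact h1.conj_mem d hdN w) i)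
      have hs0 : N.index ≠ 0 := h2.index_ne_zero
      have hxs : x ^ N.index ∈ N := N.pow_index_mem x
      obtain ⟨N', hN1, hN2, hN3⟩ := epsN φ hφ (ex x * N.index) (by
        exact mul_ne_zero hk (by exact_mod_cast hs0))
      refine ⟨N ⊓ N', inferInstance, inferInstance, fun i y hy hxy => hdN ?_⟩
      have h4 := hN3 y hy.2
      have h5 : ex h = i * ex x + ex y := by rw [← hxy, ex_mul, ex_zpow]
      have h6 : ex y = ex x * (j - i) := by linear_combination -h5 + hj
      rw [h6] at h4
      obtain ⟨c, hc⟩ := Int.dvd_of_mul_dvd_mul_left hk h4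
      have h7 : d = x ^ i * y * (x ^ i)⁻¹ * x ^ (i - j) := by
        rw [hdef, ← hxy, sub_eq_add_neg, zpow_add]; group
      rw [h7]
      refine N.mul_mem (h1.conj_mem y hy.1 _) ?_
      have : i - j = (N.index : ℤ) * (-c) := by linear_combination -hc
      rw [this, zpow_mul, zpow_natCast]
      exact N.zpow_mem hxs _
    · obtain ⟨N, hN1, hN2, hN3⟩ := epsN φ hφ (ex x) hk
      refine ⟨N, hN1, hN2, fun j y hy hxy => hd ?_⟩
      rw [← hxy, ex_mul, ex_zpow]
      exact dvd_add (Dvd.intro_left _ rfl) (hN3 y hy)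

lemma emb_mem_of_psi
    (hφψ : ∀ a : Fin n → ℤ, φ (Multiplicative.ofAdd a) = Multiplicative.ofAdd (ψ a))
    {N : Subgroup (AscHNN φ hφ)} (hN : N.Normal) (k : ℕ) (a : Fin n → ℤ)
    (h : emb φ hφ ((ψ ^ k) a) ∈ N) : emb φ hφ a ∈ N := by
  have e : emb φ hφ a = ((st φ hφ) ^ k)⁻¹ * emb φ hφ ((ψ ^ k) a) * ((st φ hφ) ^ k)⁻¹⁻¹ := by
    rw [inv_inv, mul_assoc, ← st_pow_emb hφψ]; simp
  rw [e]
  exact hN.conj_mem _ h _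

lemma not_sep
    (hφψ : ∀ a : Fin n → ℤ, φ (Multiplicative.ofAdd a) = Multiplicative.ofAdd (ψ a))
    (p : ℕ) (hp : p.Prime) (g : ℤ[X])
    (hirr : Irreducible (g.map (Int.castRingHom ℚ))) (hd : g ∣ LinearMap.charpoly ψ)
    (hg : g.map (Int.castRingHom (ZMod p)) = X ^ g.natDegree) :
    ∃ a : Fin n → ℤ, a ≠ 0 ∧ ∀ N : Subgroup (AscHNN φ hφ), N.Normal → N.FiniteIndex →
      ∃ j : ℤ, emb φ hφ (a - j • ((p : ℤ) • a)) ∈ N := by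
  obtain ⟨a, ha, hga⟩ := exists_killed ψ g hirr hd
  refine ⟨a, ha, fun N hN hfin => ?_⟩
  obtain ⟨q, hq⟩ : ∃ q : ℤ[X], X ^ g.natDegree = g + C (p : ℤ) * q := by
    have : (C (p : ℤ) : ℤ[X]) ∣ (X ^ g.natDegree - g : ℤ[X]) := by
      rw [C_dvd_iff_dvd_coeff]
      intro i
      rw [← ZMod.intCast_zmod_eq_zero_iff_dvd]
      have := congrArg (fun P : (ZMod p)[X] => coeff P i) hg
      simp only [coeff_map, eq_intCast] at this
      rw [coeff_sub, Int.cast_sub, this, coeff_X_pow, coeff_X_pow]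
      split_ifs <;> simp
    obtain ⟨q, hq⟩ := this
    exact ⟨q, by rw [← hq]; ring⟩
  set d := g.natDegree
  have hpow : ∀ k : ℕ, (ψ ^ (d * k)) a = ((p : ℤ) ^ k) • aeval ψ (q ^ k) a := by
    intro k
    have h1 : aeval ψ (((X : ℤ[X]) ^ d) ^ k) a = aeval ψ ((C (p : ℤ) * q) ^ k) a := by
      obtain ⟨r, hr⟩ : (X ^ d - C (p : ℤ) * q) ∣ (X ^ d) ^ k - (C (p : ℤ) * q) ^ k :=
        sub_dvd_pow_sub_pow _ _ _
      have h2 : (X ^ d : ℤ[X]) ^ k = (C (p : ℤ) * q) ^ k + r * g := by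
        have : (X ^ d - C (p : ℤ) * q) = g := by rw [hq]; ring
        rw [this] at hr
        linear_combination hr
      rw [h2, map_add, LinearMap.add_apply, map_mul (aeval ψ) r g, Module.End.mul_apply, hga,
        map_zero, add_zero]
    rw [← pow_mul, map_pow, aeval_X] at h1
    rw [h1, mul_pow, ← C_pow, map_mul, aeval_C, Module.End.mul_apply, Module.algebraMap_end_apply]
  obtain ⟨k, c, hc, hM⟩ := Nat.exists_eq_pow_mul_and_not_dvd (n := N.index) hfin.index_ne_zero p
    hp.ne_one
  have hca : emb φ hφ ((c : ℤ) • a) ∈ N := by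
    apply emb_mem_of_psi hφψ hN (d * k)
    rw [map_smul, hpow, smul_smul]
    have : (c : ℤ) * (p : ℤ) ^ k = (N.index : ℤ) := by rw [hM]; push_cast; ring
    rw [this, emb_zsmul, zpow_natCast]
    exact N.pow_index_mem _
  have hcop : IsCoprime (p : ℤ) (c : ℤ) := by
    rw [(Nat.prime_iff_prime_int.1 hp).coprime_iff_not_dvd]
    exact_mod_cast hc
  obtain ⟨x, y, hxy⟩ := hcop
  refine ⟨x, ?_⟩
  have : a - x • ((p : ℤ) • a) = y • ((c : ℤ) • a) := by
    rw [smul_smul, smul_smul, sub_eq_iff_eq_add, ← add_smul, add_comm, hxy, one_smul]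
  rw [this, emb_zsmul]
  exact N.zpow_mem hca y

end CSS

/-- Let `f_φ ∈ ℤ[X]` be the characteristic polynomial of `φ`
(viewed as the `ℤ`-linear endomorphism `ψ` of `ℤⁿ`).  Then `G = A∗_φ` is cyclic
subgroup separable iff there is no prime `p` and no monic polynomial `g ∈ ℤ[X]`,
irreducible over `ℚ`, dividing `f_φ` in `ℤ[X]`, with `g ≡ X^(deg g) (mod p)`. -/
theorem stmt_16 (n : ℕ) (hn : 1 ≤ n)
    (ψ : (Fin n → ℤ) →ₗ[ℤ] (Fin n → ℤ))
    (φ : FreeAb n →* FreeAb n)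
    (hφψ : ∀ a : Fin n → ℤ, φ (Multiplicative.ofAdd a) = Multiplicative.ofAdd (ψ a))
    (hφ : Function.Injective φ) :
    (∀ g h : AscHNN φ hφ, h ∉ Subgroup.zpowers g →
        ∃ N : Subgroup (AscHNN φ hφ), N.Normal ∧ N.FiniteIndex ∧
          h ∉ ((Subgroup.zpowers g : Set (AscHNN φ hφ)) * (N : Set (AscHNN φ hφ)))) ↔
      ¬ ∃ p : ℕ, p.Prime ∧ ∃ g : Polynomial ℤ, g.Monic ∧
          Irreducible (g.map (Int.castRingHom ℚ)) ∧
          g ∣ LinearMap.charpoly ψ ∧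
          g.map (Int.castRingHom (ZMod p)) = Polynomial.X ^ g.natDegree := by
  have hinj : Function.Injective ψ := by
    intro a b hab
    have : φ (Multiplicative.ofAdd a) = φ (Multiplicative.ofAdd b) := by rw [hφψ, hφψ, hab]
    exact Multiplicative.ofAdd.injective (hφ this)
  constructor
  · rintro hsep ⟨p, hp, g, -, hirr, hd, hg⟩
    obtain ⟨a, ha, hN⟩ := CSS.not_sep (hφ := hφ) hφψ p hp g hirr hd hg
    obtain ⟨N, h1, h2, h3⟩ := hsep (CSS.emb φ hφ ((p : ℤ) • a)) (CSS.emb φ hφ a) (by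
      rintro ⟨j, hj⟩
      simp only at hj
      rw [← CSS.emb_zsmul, smul_smul] at hj
      have hj := CSS.emb_inj hj
      obtain ⟨i, hi⟩ := Function.ne_iff.1 ha
      have h4 := congrFun hj i
      simp only [Pi.smul_apply, smul_eq_mul] at h4
      have h5 : j * p = 1 := mul_right_cancel₀ hi (by rw [h4, one_mul])
      exact (Nat.prime_iff_prime_int.1 hp).not_isUnit (IsUnit.of_mul_eq_one j (by rw [mul_comm, h5])))
    obtain ⟨j, hj⟩ := hN N h1 h2
    apply h3
    refine Set.mem_mul.2 ⟨CSS.emb φ hφ (j • ((p : ℤ) • a)), ⟨j, (CSS.emb_zsmul _ _).symm⟩, _, hj, ?_⟩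
    rw [← CSS.emb_add, add_sub_cancel]
  · intro hno x h hx
    obtain ⟨N, h1, h2, h3⟩ := CSS.sep_of hφψ hinj hno x h (fun j hj => hx ⟨j, hj⟩)
    refine ⟨N, h1, h2, fun hm => ?_⟩
    obtain ⟨_, ⟨j, rfl⟩, y, hy, hxy⟩ := Set.mem_mul.1 hm
    exact h3 j y hy hxy
end

section
/- Suppose n = 2, so A ≅ ℤ². Then G is cyclic subgroup separable if and only if both of the following hold: (i) there is no λ ∈ ℤ with |λ| > 1 and no nontrivial a ∈ A with φ(a) = λ·a; and (ii) the trace of φ is coprime to the determinant of φ, i.e. gcd(tr(φ), det(φ)) = 1 (trace and determinant computed with respect to any basis of A). -/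
open Subgroup Pointwise

lemma aux_CH (P : Matrix (Fin 2) (Fin 2) ℤ) :
    P * P = P.trace • P - P.det • (1 : Matrix (Fin 2) (Fin 2) ℤ) := by
  ext i j
  fin_cases i <;> fin_cases j <;>
    simp [-zsmul_eq_mul, -zsmul_one, Matrix.mul_apply, Fin.sum_univ_two, Matrix.det_fin_two,
      Matrix.trace_fin_two, Matrix.smul_apply] <;> ring

lemma aux_adj (P : Matrix (Fin 2) (Fin 2) ℤ) (N : ℤ) (n : ℕ) (v : Fin 2 → ℤ)
    (h : ∀ j, N ∣ (P ^ n).mulVec v j) (j : Fin 2) : N ∣ P.det ^ n * v j := by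
  have h1 : (Matrix.adjugate (P ^ n)).mulVec ((P ^ n).mulVec v) = P.det ^ n • v := by
    rw [Matrix.mulVec_mulVec, Matrix.adjugate_mul, Matrix.det_pow, Matrix.smul_mulVec,
      Matrix.one_mulVec]
  have h2 := congrFun h1 j
  simp only [Pi.smul_apply, smul_eq_mul] at h2
  rw [← h2]
  simp only [Matrix.mulVec, dotProduct]
  exact Finset.dvd_sum fun k _ => Dvd.dvd.mul_left (h k) _

lemma aux_split {p : ℕ} (hp : p.Prime) (e s : ℕ) (y D : ℤ) (h : (p : ℤ) ^ (e + s) ∣ y * D) :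
    (p : ℤ) ^ e ∣ y ∨ (p : ℤ) ^ s ∣ D := by
  have hp' : Prime (p : ℤ) := Nat.prime_iff_prime_int.mp hp
  induction s generalizing D with
  | zero => right; simp
  | succ s ih =>
    by_cases hD : (p : ℤ) ∣ D
    · obtain ⟨D', rfl⟩ := hD
      have : (p : ℤ) ^ (e + s) ∣ y * D' := by
        have h2 : (p : ℤ) * (p : ℤ) ^ (e + s) ∣ p * (y * D') := by
          convert h using 1 <;> ring
        exact (mul_dvd_mul_iff_left hp'.ne_zero).mp h2
      rcases ih D' this with h | h
      · exact Or.inl h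
      · right; rw [pow_succ']; exact mul_dvd_mul_left _ h
    · left
      exact (pow_dvd_pow _ (by omega)).trans (hp'.pow_dvd_of_dvd_mul_right _ hD h)

lemma aux_exists_not_dvd {p : ℕ} (hp : p.Prime) (D : ℤ) (hD : D ≠ 0) :
    ∃ s : ℕ, ¬ (p : ℤ) ^ s ∣ D := by
  have : FiniteMultiplicity (p : ℤ) D := by
    rw [Int.finiteMultiplicity_iff]
    exact ⟨by simpa using hp.one_lt.ne', hD⟩
  obtain ⟨n, hn⟩ := this
  exact ⟨n + 1, hn⟩

lemma aux_bezout (c b : Fin 2 → ℤ) (x y : ℤ) (h : x * c 0 + y * c 1 = 1)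
    (hd : c 0 * b 1 = c 1 * b 0) : b = (x * b 0 + y * b 1) • c := by
  ext i
  fin_cases i <;> simp
  · linear_combination (-b 0) * h - y * hd
  · linear_combination (-b 1) * h + x * hd

lemma aux_prim (a : Fin 2 → ℤ) (ha : a ≠ 0) :
    ∃ (c : Fin 2 → ℤ) (n x y : ℤ), a = n • c ∧ n ≠ 0 ∧ x * c 0 + y * c 1 = 1 := by
  have hg : (Int.gcd (a 0) (a 1) : ℤ) ≠ 0 := by
    intro h
    have := Int.gcd_eq_zero_iff.mp (by exact_mod_cast h)
    apply ha; ext i; fin_cases i <;> simp [this]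
  obtain ⟨u, hu⟩ := Int.gcd_dvd_left (a := a 0) (b := a 1)
  obtain ⟨v, hv⟩ := Int.gcd_dvd_right (a := a 0) (b := a 1)
  have hb := Int.gcd_eq_gcd_ab (a 0) (a 1)
  set g : ℤ := (Int.gcd (a 0) (a 1) : ℤ)
  refine ⟨![u, v], g, Int.gcdA (a 0) (a 1), Int.gcdB (a 0) (a 1), ?_, hg, ?_⟩
  · ext i; fin_cases i <;> simp [← hu, ← hv]
  · apply mul_left_cancel₀ hg
    simp
    linear_combination -hb - (Int.gcdA (a 0) (a 1)) * hu - (Int.gcdB (a 0) (a 1)) * hv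

lemma aux_pow (P : Matrix (Fin 2) (Fin 2) ℤ) {p : ℤ} (hp : Prime p) (hd : p ∣ P.det)
    (ht : ¬ p ∣ P.trace) (n : ℕ) :
    ∃ u w : ℤ, ¬ p ∣ u ∧ p ∣ w ∧ P ^ (n + 1) = u • P + w • (1 : Matrix (Fin 2) (Fin 2) ℤ) := by
  induction n with
  | zero => exact ⟨1, 0, fun h => hp.not_isUnit (isUnit_of_dvd_one h), dvd_zero _, by simp⟩
  | succ n ih =>
    obtain ⟨u, w, hu, hw, h⟩ := ih
    refine ⟨u * P.trace + w, -(u * P.det), ?_, ?_, ?_⟩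
    · rw [dvd_add_left hw]
      intro h; rcases hp.dvd_or_dvd h with h | h
      · exact hu h
      · exact ht h
    · exact (hd.mul_left _).neg_right
    · rw [pow_succ, h, add_mul, smul_mul_assoc, aux_CH, smul_mul_assoc, one_mul]
      module

/-- Multiples of a primitive vector. -/
lemma aux_line (P : Matrix (Fin 2) (Fin 2) ℤ) (hd : P.det ≠ 0)
    (hg : Int.gcd P.trace P.det = 1)
    (hev : ¬ ∃ lam : ℤ, 1 < |lam| ∧ ∃ a : Fin 2 → ℤ, a ≠ 0 ∧ P.mulVec a = lam • a)
    (c : Fin 2 → ℤ) (x y : ℤ) (hc : x * c 0 + y * c 1 = 1) {p : ℕ} (hp : p.Prime) :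
    ∃ D : ℤ, D ≠ 0 ∧ ∀ (n K : ℕ) (z : ℤ),
      (∀ j, (p : ℤ) ^ K ∣ (P ^ (n + 1)).mulVec (z • c) j) → (p : ℤ) ^ K ∣ z * D := by
  have hp' : Prime (p : ℤ) := Nat.prime_iff_prime_int.mp hp
  by_cases hpd : (p : ℤ) ∣ P.det
  · have hpt : ¬ (p : ℤ) ∣ P.trace := by
      intro h
      have := Int.dvd_coe_gcd h hpd
      rw [hg] at this
      exact hp'.not_isUnit (isUnit_of_dvd_one (by simpa using this))
    by_cases hD : c 0 * P.mulVec c 1 = c 1 * P.mulVec c 0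
    · -- eigenvector
      have hl := aux_bezout c _ x y hc hD
      generalize x * P.mulVec c 0 + y * P.mulVec c 1 = l at hl
      have hc0 : c ≠ 0 := by rintro rfl; simp at hc
      have hPn : ∀ n, (P ^ n).mulVec c = l ^ n • c := by
        intro n
        induction n with
        | zero => simp
        | succ n ih =>
          rw [pow_succ, ← Matrix.mulVec_mulVec, hl, Matrix.mulVec_smul, ih, smul_smul, pow_succ']
      have hl1 : |l| ≤ 1 := by
        by_contra h
        exact hev ⟨l, by omega, c, hc0, hl⟩
      have hl0 : l ≠ 0 := by
        rintro rfl
        have h0 : P.mulVec c = 0 := by simpa using hl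
        exact hc0 (Matrix.eq_zero_of_mulVec_eq_zero hd h0)
      have hlu : IsUnit l := by
        rw [Int.isUnit_iff_abs_eq]
        have := abs_pos.mpr hl0
        omega
      refine ⟨1, one_ne_zero, fun n K z h => ?_⟩
      simp only [Matrix.mulVec_smul, hPn, Pi.smul_apply, smul_eq_mul] at h
      have h1 : (p : ℤ) ^ K ∣ z * l ^ (n + 1) := by
        have := dvd_add ((h 0).mul_left x) ((h 1).mul_left y)
        refine this.trans (dvd_of_eq ?_)
        linear_combination (z * l ^ (n + 1)) * hc
      rw [mul_one]
      exact ((hlu.pow (n + 1)).dvd_mul_right).mp h1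
    · refine ⟨c 0 * P.mulVec c 1 - c 1 * P.mulVec c 0, sub_ne_zero.mpr hD, fun n K z h => ?_⟩
      obtain ⟨u, w, hu, hw, he⟩ := aux_pow P hp' hpd hpt n
      simp only [he, Matrix.mulVec_smul, Matrix.add_mulVec, Matrix.smul_mulVec, Matrix.one_mulVec,
        Pi.smul_apply, Pi.add_apply, smul_eq_mul] at h
      have h1 : (p : ℤ) ^ K ∣ u * (z * (c 0 * P.mulVec c 1 - c 1 * P.mulVec c 0)) := by
        have := dvd_sub ((h 1).mul_left (c 0)) ((h 0).mul_left (c 1))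
        refine this.trans (dvd_of_eq ?_)
        ring
      exact hp'.pow_dvd_of_dvd_mul_left _ hu h1
  · refine ⟨1, one_ne_zero, fun n K z h => ?_⟩
    have h1 := aux_adj P _ _ _ h
    have h2 : ∀ j, (p : ℤ) ^ K ∣ (z • c) j := fun j =>
      hp'.pow_dvd_of_dvd_mul_left _ (fun hh => hpd (hp'.dvd_of_dvd_pow hh)) (h1 j)
    have := dvd_add ((h2 0).mul_left x) ((h2 1).mul_left y)
    refine this.trans (dvd_of_eq ?_)
    simp
    linear_combination z * hc

lemma aux_main (P : Matrix (Fin 2) (Fin 2) ℤ) (hd : P.det ≠ 0)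
    (hg : Int.gcd P.trace P.det = 1)
    (hev : ¬ ∃ lam : ℤ, 1 < |lam| ∧ ∃ a : Fin 2 → ℤ, a ≠ 0 ∧ P.mulVec a = lam • a)
    (a b : Fin 2 → ℤ) (hab : ∀ i : ℤ, b ≠ i • a) :
    ∃ N : ℕ, N ≠ 0 ∧ ∀ (n : ℕ) (i : ℤ),
      ¬ ∀ j, (N : ℤ) ∣ (P ^ (n + 1)).mulVec (b - i • a) j := by
  have key : ∀ (c : Fin 2 → ℤ) (n0 m0 x y : ℤ), x * c 0 + y * c 1 = 1 → a = n0 • c →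
      b = m0 • c → ∃ N : ℕ, N ≠ 0 ∧ ∀ (n : ℕ) (i : ℤ),
      ¬ ∀ j, (N : ℤ) ∣ (P ^ (n + 1)).mulVec (b - i • a) j := by
    intro c n0 m0 x y hc ha hb
    have hnd : ¬ n0.natAbs ∣ m0.natAbs := by
      rw [Int.natAbs_dvd_natAbs]
      rintro ⟨k, rfl⟩
      exact hab k (by rw [ha, hb, smul_smul, mul_comm])
    rw [Nat.dvd_iff_prime_pow_dvd_dvd] at hnd
    push Not at hnd
    obtain ⟨p, e, hp, h1, h2⟩ := hnd
    have h1' : (p : ℤ) ^ e ∣ n0 := by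
      rw [← Int.dvd_natAbs]; exact_mod_cast h1
    have h2' : ¬ (p : ℤ) ^ e ∣ m0 := by
      rw [← Int.dvd_natAbs]; exact_mod_cast h2
    obtain ⟨D, hD, H⟩ := aux_line P hd hg hev c x y hc hp
    obtain ⟨s, hs⟩ := aux_exists_not_dvd hp D hD
    refine ⟨p ^ (e + s), pow_ne_zero _ hp.ne_zero, fun n i h => ?_⟩
    have h3 : b - i • a = (m0 - i * n0) • c := by rw [ha, hb]; module
    rw [h3] at h
    push_cast at h
    rcases aux_split hp e s _ _ (H n _ _ h) with h | h
    · exact h2' ((dvd_sub_left (h1'.mul_left i)).mp h)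
    · exact hs h
  by_cases hdet : a 0 * b 1 = a 1 * b 0
  · by_cases ha : a = 0
    · have hb : b ≠ 0 := by simpa using hab 0
      obtain ⟨c, n, x, y, h1, -, h2⟩ := aux_prim b hb
      exact key c 0 n x y h2 (by simp [ha]) h1
    · obtain ⟨c, n, x, y, h1, hn, h2⟩ := aux_prim a ha
      refine key c n _ x y h2 h1 (aux_bezout c b x y h2 ?_)
      rw [h1] at hdet
      apply mul_left_cancel₀ hn
      simp at hdet
      linear_combination hdet
  · set D := a 0 * b 1 - a 1 * b 0 with hDdef
    have hD : D ≠ 0 := sub_ne_zero.mpr hdet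
    obtain ⟨p, hpl, hp⟩ := Nat.exists_infinite_primes ((P.det * D).natAbs + 1)
    have hp' : Prime (p : ℤ) := Nat.prime_iff_prime_int.mp hp
    have hnd : ¬ (p : ℤ) ∣ P.det * D := by
      intro h
      have := Nat.le_of_dvd (Int.natAbs_pos.mpr (mul_ne_zero hd hD)) (Int.natCast_dvd.mp h)
      omega
    refine ⟨p, hp.ne_zero, fun n i h => ?_⟩
    have h1 := aux_adj P _ _ _ h
    have h2 : ∀ j, (p : ℤ) ∣ (b - i • a) j := fun j =>
      ((hp'.dvd_or_dvd (h1 j)).resolve_left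
        (fun hh => hnd ((hp'.dvd_of_dvd_pow hh).mul_right _)))
    apply hnd
    apply Dvd.dvd.mul_left
    have := dvd_sub ((h2 1).mul_left (a 0)) ((h2 0).mul_left (a 1))
    refine this.trans (dvd_of_eq ?_)
    simp [hDdef]
    ring

lemma aux_idem {M : Type*} [Monoid M] [Finite M] (x : M) :
    ∃ n : ℕ, x ^ (n + 1) * x ^ (n + 1) = x ^ (n + 1) := by
  obtain ⟨i, j, hij, h⟩ := Finite.exists_ne_map_eq_of_infinite (fun n : ℕ => x ^ n)
  wlog hlt : i < j generalizing i j
  · exact this j i hij.symm h.symm (by omega)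
  obtain ⟨q, rfl⟩ := Nat.exists_eq_add_of_lt hlt
  have h1 : ∀ m k, x ^ (i + m + (q + 1) * k) = x ^ (i + m) := by
    intro m k
    induction k with
    | zero => simp
    | succ k ih =>
      have : i + m + (q + 1) * (k + 1) = (i + q + 1) + (m + (q + 1) * k) := by ring
      rw [this, pow_add, ← h, ← pow_add, ← ih]
      congr 1; ring
  have hle : i ≤ (q + 1) * (i + 1) := by nlinarith
  obtain ⟨m, hm⟩ := Nat.exists_eq_add_of_le hle
  have hpos : 0 < (q + 1) * (i + 1) := by positivity
  refine ⟨(q + 1) * (i + 1) - 1, ?_⟩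
  rw [Nat.sub_add_cancel hpos, ← pow_add]
  have := h1 m (i + 1)
  rwa [← hm] at this

/-- The affine representation modulo `N`. -/
lemma aux_hom (ψ : (Fin 2 → ℤ) →ₗ[ℤ] (Fin 2 → ℤ)) (φ : FreeAb 2 →* FreeAb 2)
    (hφψ : ∀ a : Fin 2 → ℤ, φ (Multiplicative.ofAdd a) = Multiplicative.ofAdd (ψ a))
    (hφ : Function.Injective φ) (P : Matrix (Fin 2) (Fin 2) ℤ) (hP : ∀ a, ψ a = P.mulVec a)
    (N : ℕ) (hN : N ≠ 0) :
    ∃ (F : Type) (_ : Group F) (_ : Finite F) (f : AscHNN φ hφ →* F) (n : ℕ),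
      ∀ a b : Fin 2 → ℤ, f (HNNExtension.of (Multiplicative.ofAdd b)) ∈
        Subgroup.zpowers (f (HNNExtension.of (Multiplicative.ofAdd a))) →
        ∃ i : ℤ, ∀ j, (N : ℤ) ∣ (P ^ (n + 1)).mulVec (b - i • a) j := by
  have : NeZero N := ⟨hN⟩
  let κ : ℤ →+* ZMod N := Int.castRingHom (ZMod N)
  let Q : Matrix (Fin 2) (Fin 2) (ZMod N) := κ.mapMatrix P
  obtain ⟨n, hE⟩ := aux_idem Q
  set E := Q ^ (n + 1) with hEdef
  have hQE : Q * E = E * Q := by rw [hEdef, ← pow_succ, ← pow_succ']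
  have hQnE : Q ^ n * E = E * Q ^ n := by rw [hEdef, ← pow_add, ← pow_add, add_comm]
  let α := Q * E + (1 - E)
  let β := Q ^ n * E + (1 - E)
  have hE1 : E * (1 - E) = 0 := by rw [mul_sub, hE, mul_one, sub_self]
  have hE2 : (1 - E) * E = 0 := by rw [sub_mul, hE, one_mul, sub_self]
  have hE3 : (1 - E) * (1 - E) = 1 - E := by rw [sub_mul, hE1, one_mul, sub_zero]
  have hαβ : α * β = 1 := by
    have h1 : Q * E * (Q ^ n * E) = E := by
      rw [hQnE, ← mul_assoc, mul_assoc Q E E, hE, hQE, mul_assoc, ← pow_succ', hE]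
    have h2 : Q * E * (1 - E) = 0 := by rw [mul_assoc, hE1, mul_zero]
    have h3 : (1 - E) * (Q ^ n * E) = 0 := by rw [hQnE, ← mul_assoc, hE2, zero_mul]
    simp only [α, β, mul_add, add_mul, h1, h2, h3, hE3]
    abel
  have hβα : β * α = 1 := mul_eq_one_comm.mp hαβ
  have hαE : α * E = E * Q := by
    rw [show α = Q * E + (1 - E) from rfl, add_mul, hE2, mul_assoc, hE, hQE, add_zero]
  let cst : (Fin 2 → ℤ) → (Fin 2 → ZMod N) := fun a => κ ∘ a
  have hcst : ∀ a, cst (P.mulVec a) = Q.mulVec (cst a) := by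
    intro a; ext j; exact RingHom.map_mulVec κ P a j
  have hcstn : ∀ m a, cst ((P ^ m).mulVec a) = (Q ^ m).mulVec (cst a) := by
    intro m a; ext j
    have := RingHom.map_mulVec κ (P ^ m) a j
    have h2 : Q ^ m = (P ^ m).map κ := by
      simp only [Q, ← map_pow]; rfl
    rw [h2]; exact this
  have hcadd : ∀ a b, cst (a + b) = cst a + cst b := by
    intro a b; ext j; simp [cst]
  have hcsmul : ∀ (i : ℤ) a, cst (i • a) = i • cst a := by
    intro i a; ext j; simp [cst]
  let W := Fin 2 → ZMod N
  let T : FreeAb 2 →* Equiv.Perm W :=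
    { toFun := fun a => Equiv.addLeft (E.mulVec (cst a.toAdd))
      map_one' := by
        ext w : 1
        have : cst 0 = 0 := by ext j; simp [cst]
        simp [this]
      map_mul' := by
        intro a b
        ext w : 1
        change E.mulVec (cst (a.toAdd + b.toAdd)) + w =
          E.mulVec (cst a.toAdd) + (E.mulVec (cst b.toAdd) + w)
        rw [hcadd, Matrix.mulVec_add, add_assoc] }
  let x : Equiv.Perm W :=
    { toFun := fun w => α.mulVec w
      invFun := fun w => β.mulVec w
      left_inv := by intro w; beta_reduce; rw [Matrix.mulVec_mulVec, hβα, Matrix.one_mulVec]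
      right_inv := by intro w; beta_reduce; rw [Matrix.mulVec_mulVec, hαβ, Matrix.one_mulVec] }
  have hrel : ∀ a : (⊤ : Subgroup (FreeAb 2)),
      x * T (a : FreeAb 2) = T (ascIso φ hφ a : FreeAb 2) * x := by
    rintro ⟨a, ha⟩
    have h1 : ((ascIso φ hφ ⟨a, ha⟩ : φ.range) : FreeAb 2) = Multiplicative.ofAdd (ψ a.toAdd) := by
      rw [← hφψ]; rfl
    rw [h1]
    ext w : 1
    change α.mulVec (E.mulVec (cst a.toAdd) + w) =
      E.mulVec (cst (ψ a.toAdd)) + α.mulVec w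
    rw [hP, hcst, Matrix.mulVec_add, Matrix.mulVec_mulVec, Matrix.mulVec_mulVec, hαE]
  refine ⟨Equiv.Perm W, inferInstance, inferInstance, HNNExtension.lift T x hrel, n, ?_⟩
  intro a b hab
  rw [HNNExtension.lift_of, HNNExtension.lift_of] at hab
  obtain ⟨i, hi⟩ := Subgroup.mem_zpowers_iff.mp hab
  refine ⟨i, fun j => ?_⟩
  rw [← map_zpow, ← ofAdd_zsmul] at hi
  have h0 := congrArg (fun e : Equiv.Perm W => e 0) hi
  simp only [T, MonoidHom.coe_mk, OneHom.coe_mk, Equiv.coe_addLeft, toAdd_ofAdd, add_zero] at h0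
  have h1 : cst ((P ^ (n + 1)).mulVec (b - i • a)) = 0 := by
    rw [hcstn, ← hEdef, sub_eq_add_neg, hcadd, Matrix.mulVec_add, ← h0, ← Matrix.mulVec_add,
      ← hcadd, add_neg_cancel]
    have : cst 0 = 0 := by ext j; simp [cst]
    simp [this]
  have h2 := congrFun h1 j
  exact (ZMod.intCast_zmod_eq_zero_iff_dvd _ N).mp h2

lemma aux_sep_of_hom {G F : Type*} [Group G] [Group F] [Finite F] (f : G →* F) (g h : G)
    (H : f h ∉ Subgroup.zpowers (f g)) : ∃ N : Subgroup G, N.Normal ∧ N.FiniteIndex ∧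
      h ∉ ((Subgroup.zpowers g : Set G) * (N : Set G)) := by
  refine ⟨f.ker, inferInstance, inferInstance, ?_⟩
  rintro ⟨x, hx, y, hy, rfl⟩
  obtain ⟨i, rfl⟩ := Subgroup.mem_zpowers_iff.mp hx
  apply H
  have : f y = 1 := hy
  simp only [map_mul, this, mul_one, map_zpow]
  exact Subgroup.zpow_mem_zpowers _ _

lemma aux_not_sep {G : Type*} [Group G] (g h : G)
    (H : ∀ N : Subgroup G, ∀ [N.Normal] [N.FiniteIndex],
      (h : G ⧸ N) ∈ Subgroup.zpowers (g : G ⧸ N)) (hgh : h ∉ Subgroup.zpowers g) :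
    ¬ ∀ g h : G, h ∉ Subgroup.zpowers g → ∃ N : Subgroup G, N.Normal ∧ N.FiniteIndex ∧
      h ∉ ((Subgroup.zpowers g : Set G) * (N : Set G)) := by
  intro hall
  obtain ⟨N, h1, h2, h3⟩ := hall g h hgh
  obtain ⟨i, hi⟩ := Subgroup.mem_zpowers_iff.mp (H N)
  apply h3
  refine ⟨g ^ i, Subgroup.zpow_mem_zpowers _ _, (g ^ i)⁻¹ * h, ?_, by simp⟩
  rw [← QuotientGroup.mk_zpow] at hi
  exact QuotientGroup.eq.mp hi

section HNN
variable {φ : FreeAb 2 →* FreeAb 2} {hφ : Function.Injective φ}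

lemma aux_t_mul (a : FreeAb 2) : (HNNExtension.t : AscHNN φ hφ) * HNNExtension.of a =
    HNNExtension.of (φ a) * HNNExtension.t :=
  HNNExtension.t_mul_of (φ := ascIso φ hφ) ⟨a, trivial⟩

lemma aux_tpow_mul (k : ℕ) (a : FreeAb 2) :
    (HNNExtension.t : AscHNN φ hφ) ^ k * HNNExtension.of a =
    HNNExtension.of ((φ : FreeAb 2 → FreeAb 2)^[k] a) * HNNExtension.t ^ k := by
  induction k generalizing a with
  | zero => simp
  | succ k ih =>
    rw [pow_succ, mul_assoc, aux_t_mul, ← mul_assoc, ih, mul_assoc, Function.iterate_succ_apply]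

lemma aux_form (g : AscHNN φ hφ) : ∃ (i j : ℕ) (a : FreeAb 2),
    g = (HNNExtension.t ^ i)⁻¹ * HNNExtension.of a * HNNExtension.t ^ j := by
  induction g using HNNExtension.induction_on with
  | of a => exact ⟨0, 0, a, by simp⟩
  | t => exact ⟨0, 1, 1, by simp⟩
  | mul x y hx hy =>
    obtain ⟨i, j, a, rfl⟩ := hx
    obtain ⟨k, l, b, rfl⟩ := hy
    rcases le_total k j with h | h
    · obtain ⟨m, rfl⟩ := Nat.exists_eq_add_of_le h
      refine ⟨i, m + l, a * (φ : FreeAb 2 → FreeAb 2)^[m] b, ?_⟩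
      have := aux_tpow_mul (hφ := hφ) m b
      rw [← mul_inv_eq_iff_eq_mul] at this
      rw [map_mul, ← this, add_comm k m]
      simp only [pow_add]
      group
    · obtain ⟨m, rfl⟩ := Nat.exists_eq_add_of_le h
      refine ⟨i + m, l, (φ : FreeAb 2 → FreeAb 2)^[m] a * b, ?_⟩
      have := aux_tpow_mul (hφ := hφ) m a
      rw [← mul_inv_eq_iff_eq_mul] at this
      rw [map_mul, ← this, add_comm i m]
      simp only [pow_add]
      group
  | inv x hx =>
    obtain ⟨i, j, a, rfl⟩ := hx
    exact ⟨j, i, a⁻¹, by simp [mul_assoc]⟩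

/-- The exponent sum of `t`. -/
noncomputable def auxExp (φ : FreeAb 2 →* FreeAb 2) (hφ : Function.Injective φ) :
    AscHNN φ hφ →* Multiplicative ℤ :=
  HNNExtension.lift 1 (Multiplicative.ofAdd 1) (by simp)

lemma auxExp_form (i j : ℕ) (a : FreeAb 2) :
    (auxExp φ hφ ((HNNExtension.t ^ i)⁻¹ * HNNExtension.of a * HNNExtension.t ^ j)).toAdd
      = (j : ℤ) - i := by
  simp [auxExp]
  ring

end HNN

/-- `h` is separated from `⟨g⟩` in some finite quotient. -/
def AuxSep {G : Type} [Group G] (g h : G) : Prop :=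
  ∃ (F : Type) (_ : Group F) (_ : Finite F) (f : G →* F), f h ∉ Subgroup.zpowers (f g)

lemma aux_sep_conj {G : Type} [Group G] (g h x : G) (H : AuxSep (x * g * x⁻¹) (x * h * x⁻¹)) :
    AuxSep g h := by
  obtain ⟨F, i1, i2, f, hf⟩ := H
  refine ⟨F, i1, i2, f, fun hh => hf ?_⟩
  obtain ⟨i, hi⟩ := Subgroup.mem_zpowers_iff.mp hh
  refine Subgroup.mem_zpowers_iff.mpr ⟨i, ?_⟩
  simp only [map_mul, map_inv, conj_zpow, hi]

lemma aux_case2 {φ : FreeAb 2 →* FreeAb 2} {hφ : Function.Injective φ}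
    (H : ∀ a b : FreeAb 2, b ∉ Subgroup.zpowers a →
      AuxSep (HNNExtension.of a : AscHNN φ hφ) (HNNExtension.of b))
    (g h : AscHNN φ hφ) (hg : (auxExp φ hφ g).toAdd = 0) (hh : (auxExp φ hφ h).toAdd = 0)
    (hgh : h ∉ Subgroup.zpowers g) : AuxSep g h := by
  obtain ⟨i, j, a, rfl⟩ := aux_form g
  obtain ⟨k, l, b, rfl⟩ := aux_form h
  rw [auxExp_form] at hg hh
  obtain rfl : j = i := by omega
  obtain rfl : l = k := by omega
  have e1 := aux_tpow_mul (hφ := hφ) l a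
  have e2 := aux_tpow_mul (hφ := hφ) j b
  rw [← mul_inv_eq_iff_eq_mul] at e1 e2
  have c1 : (HNNExtension.t ^ (j + l) : AscHNN φ hφ) *
      ((HNNExtension.t ^ j)⁻¹ * HNNExtension.of a * HNNExtension.t ^ j) *
      (HNNExtension.t ^ (j + l))⁻¹ = HNNExtension.of ((φ : FreeAb 2 → FreeAb 2)^[l] a) := by
    rw [← e1, add_comm j l, pow_add]; group
  have c2 : (HNNExtension.t ^ (j + l) : AscHNN φ hφ) *
      ((HNNExtension.t ^ l)⁻¹ * HNNExtension.of b * HNNExtension.t ^ l) *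
      (HNNExtension.t ^ (j + l))⁻¹ = HNNExtension.of ((φ : FreeAb 2 → FreeAb 2)^[j] b) := by
    rw [← e2, pow_add]; group
  apply aux_sep_conj _ _ (HNNExtension.t ^ (j + l))
  rw [c1, c2]
  apply H
  intro hm
  obtain ⟨m, hm⟩ := Subgroup.mem_zpowers_iff.mp hm
  apply hgh
  refine Subgroup.mem_zpowers_iff.mpr ⟨m, ?_⟩
  have := congrArg (HNNExtension.of (φ := ascIso φ hφ)) hm
  rw [map_zpow, ← c1, ← c2, conj_zpow] at this
  exact mul_left_cancel (mul_right_cancel this)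

lemma aux_all {φ : FreeAb 2 →* FreeAb 2} {hφ : Function.Injective φ}
    (H : ∀ a b : FreeAb 2, b ∉ Subgroup.zpowers a →
      AuxSep (HNNExtension.of a : AscHNN φ hφ) (HNNExtension.of b))
    (g h : AscHNN φ hφ) (hgh : h ∉ Subgroup.zpowers g) : AuxSep g h := by
  set k := (auxExp φ hφ g).toAdd with hk
  set l := (auxExp φ hφ h).toAdd with hl
  let ρ : (r : ℕ) → AscHNN φ hφ →* Multiplicative (ZMod r) := fun r =>
    (AddMonoidHom.toMultiplicative (Int.castAddHom (ZMod r))).comp (auxExp φ hφ)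
  have hρ : ∀ r x, ρ r x = Multiplicative.ofAdd (((auxExp φ hφ x).toAdd : ℤ) : ZMod r) :=
    fun r x => rfl
  by_cases hkl : k ∣ l
  · by_cases hk0 : k = 0
    · apply aux_case2 H g h hk0 _ hgh
      rw [hk0] at hkl
      exact zero_dvd_iff.mp hkl
    · obtain ⟨q, hq⟩ := hkl
      have hx1 : h * (g ^ q)⁻¹ ∉ Subgroup.zpowers (1 : AscHNN φ hφ) := by
        intro hh
        simp only [Subgroup.zpowers_one_eq_bot, Subgroup.mem_bot] at hh
        apply hgh
        rw [mul_inv_eq_one] at hh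
        rw [hh]
        exact Subgroup.zpow_mem_zpowers _ _
      have hx2 : (auxExp φ hφ (h * (g ^ q)⁻¹)).toAdd = 0 := by
        simp only [map_mul, map_inv, map_zpow, toAdd_mul, toAdd_inv, toAdd_zpow, ← hk, ← hl, hq,
          smul_eq_mul]
        ring
      obtain ⟨F, i1, i2, f, hf⟩ := aux_case2 H 1 _ (by simp) hx2 hx1
      have hF : 0 < Nat.card F := Nat.card_pos
      let r := k.natAbs * Nat.card F
      have hr : NeZero r := ⟨mul_ne_zero (by simpa using hk0) hF.ne'⟩
      have : Finite (Multiplicative (ZMod r)) := inferInstanceAs (Finite (ZMod r))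
      refine ⟨F × Multiplicative (ZMod r), inferInstance, inferInstance, f.prod (ρ r), ?_⟩
      intro hm
      obtain ⟨m, hm⟩ := Subgroup.mem_zpowers_iff.mp hm
      rw [← map_zpow, MonoidHom.prod_apply, MonoidHom.prod_apply, Prod.mk.injEq] at hm
      obtain ⟨m1, m2⟩ := hm
      have m3 : ((m * k : ℤ) : ZMod r) = ((l : ℤ) : ZMod r) := by
        have := congrArg Multiplicative.toAdd m2
        simpa only [hρ, toAdd_ofAdd, map_zpow, toAdd_zpow, smul_eq_mul] using this
      rw [ZMod.intCast_eq_intCast_iff_dvd_sub, hq] at m3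
      have m4 : (Nat.card F : ℤ) ∣ q - m := by
        have h5 : k * (Nat.card F : ℤ) ∣ k * (q - m) := by
          have h6 : k * (Nat.card F : ℤ) ∣ (r : ℤ) := by
            simp only [r]; push_cast
            exact mul_dvd_mul_right (self_dvd_abs k) _
          refine (h6.trans m3).trans (dvd_of_eq ?_)
          ring
        exact (mul_dvd_mul_iff_left hk0).mp h5
      obtain ⟨s, hs⟩ := m4
      apply hf
      have : f (h * (g ^ q)⁻¹) = 1 := by
        rw [map_mul, map_inv, ← m1, map_zpow, map_zpow, ← zpow_neg, ← zpow_add]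
        have : m + -q = (Nat.card F : ℤ) * (-s) := by linear_combination -hs
        rw [this, zpow_mul, zpow_natCast, pow_card_eq_one', one_zpow]
      rw [this]
      exact one_mem _
  · by_cases hk0 : k = 0
    · have hl0 : l ≠ 0 := fun h => hkl (by rw [h]; exact dvd_zero _)
      let r := l.natAbs + 1
      have : Finite (Multiplicative (ZMod r)) := inferInstanceAs (Finite (ZMod r))
      refine ⟨Multiplicative (ZMod r), inferInstance, inferInstance, ρ r, ?_⟩
      intro hm
      obtain ⟨m, hm⟩ := Subgroup.mem_zpowers_iff.mp hm
      have m3 : ((m * k : ℤ) : ZMod r) = ((l : ℤ) : ZMod r) := by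
        rw [← map_zpow] at hm
        have := congrArg Multiplicative.toAdd hm
        simpa only [hρ, toAdd_ofAdd, map_zpow, toAdd_zpow, smul_eq_mul] using this
      rw [ZMod.intCast_eq_intCast_iff_dvd_sub, hk0, mul_zero, sub_zero] at m3
      have := Nat.le_of_dvd (Int.natAbs_pos.mpr hl0) (Int.natCast_dvd.mp m3)
      omega
    · let r := k.natAbs
      have hr : NeZero r := ⟨by simpa [r] using hk0⟩
      have : Finite (Multiplicative (ZMod r)) := inferInstanceAs (Finite (ZMod r))
      refine ⟨Multiplicative (ZMod r), inferInstance, inferInstance, ρ r, ?_⟩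
      intro hm
      obtain ⟨m, hm⟩ := Subgroup.mem_zpowers_iff.mp hm
      have m3 : ((m * k : ℤ) : ZMod r) = ((l : ℤ) : ZMod r) := by
        rw [← map_zpow] at hm
        have := congrArg Multiplicative.toAdd hm
        simpa only [hρ, toAdd_ofAdd, map_zpow, toAdd_zpow, smul_eq_mul] using this
      rw [ZMod.intCast_eq_intCast_iff_dvd_sub] at m3
      apply hkl
      have m5 : k ∣ l - m * k := Int.natAbs_dvd.mp m3
      exact (dvd_sub_left (Dvd.intro_left m rfl)).mp m5

lemma aux_finite_conj {Q : Type*} [Group Q] [Finite Q] (t g : Q) (l : ℤ)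
    (h : t * g * t⁻¹ = g ^ l) : t⁻¹ * g * t ∈ Subgroup.zpowers g := by
  have h1 : (t⁻¹ * g * t) ^ l = g := by
    have := conj_zpow (a := t⁻¹) (b := g) (i := l)
    rw [inv_inv] at this
    rw [this, ← h]; group
  have hle : Subgroup.zpowers g ≤ Subgroup.zpowers (t⁻¹ * g * t) := by
    rw [Subgroup.zpowers_le]
    exact Subgroup.mem_zpowers_iff.mpr ⟨l, h1⟩
  have ho : orderOf (t⁻¹ * g * t) = orderOf g := by
    have hs : SemiconjBy t (t⁻¹ * g * t) g := by simp [SemiconjBy, mul_assoc]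
    exact SemiconjBy.orderOf_eq _ hs
  have := Subgroup.eq_of_le_of_card_ge hle (by rw [Nat.card_zpowers, Nat.card_zpowers, ho])
  rw [this]
  exact Subgroup.mem_zpowers _

lemma aux_finite_pow {Q : Type*} [Group Q] [Finite Q] (g : Q) {p : ℕ} (hp : p.Prime)
    (h : ∀ k : ℕ, ∃ x s : Q, x * g * x⁻¹ = s ^ (p ^ k)) : g ∈ Subgroup.zpowers (g ^ p) := by
  rw [mem_zpowers_pow_iff]
  have hQ : Nat.card Q ≠ 0 := Nat.card_pos.ne'
  obtain ⟨k, m, hm, hcard⟩ := Nat.exists_eq_pow_mul_and_not_dvd hQ p hp.ne_one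
  obtain ⟨x, s, hx⟩ := h k
  have h1 : g ^ m = 1 := by
    have h2 : (x * g * x⁻¹) ^ m = 1 := by
      rw [hx, ← pow_mul, ← hcard, pow_card_eq_one']
    rw [conj_pow] at h2
    simpa using h2
  have h3 : orderOf g ∣ m := orderOf_dvd_of_pow_eq_one h1
  have : Nat.Coprime p (orderOf g) :=
    (Nat.Prime.coprime_iff_not_dvd hp).mpr (fun hh => hm (hh.trans h3))
  exact this

/-- Suppose `A ≅ ℤ²`.  Then `G = A∗_φ` is cyclic subgroup
separable iff (i) `φ` (equivalently, its `ℤ`-linear version `ψ`) has no integer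
eigenvalue `λ` with `|λ| > 1`, and (ii) `gcd(tr(φ), det(φ)) = 1`. -/
theorem stmt_18
    (ψ : (Fin 2 → ℤ) →ₗ[ℤ] (Fin 2 → ℤ))
    (φ : FreeAb 2 →* FreeAb 2)
    (hφψ : ∀ a : Fin 2 → ℤ, φ (Multiplicative.ofAdd a) = Multiplicative.ofAdd (ψ a))
    (hφ : Function.Injective φ) :
    (∀ g h : AscHNN φ hφ, h ∉ Subgroup.zpowers g →
        ∃ N : Subgroup (AscHNN φ hφ), N.Normal ∧ N.FiniteIndex ∧
          h ∉ ((Subgroup.zpowers g : Set (AscHNN φ hφ)) * (N : Set (AscHNN φ hφ)))) ↔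
      ((¬ ∃ lam : ℤ, 1 < |lam| ∧ ∃ a : Fin 2 → ℤ, a ≠ 0 ∧ ψ a = lam • a) ∧
        Int.gcd (LinearMap.trace ℤ (Fin 2 → ℤ) ψ) (LinearMap.det ψ) = 1) := by
  set P : Matrix (Fin 2) (Fin 2) ℤ := LinearMap.toMatrix' ψ with hPdef
  have hP : ∀ a, ψ a = P.mulVec a := fun a => (LinearMap.toMatrix'_mulVec ψ a).symm
  have hdet : LinearMap.det ψ = P.det := (LinearMap.det_toMatrix' ψ).symm
  have htr : LinearMap.trace ℤ (Fin 2 → ℤ) ψ = P.trace := by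
    rw [← Matrix.trace_toLin'_eq, hPdef, Matrix.toLin'_toMatrix']
  have hψ0 : ∀ a, ψ a = 0 → a = 0 := by
    intro a ha
    have h1 : φ (Multiplicative.ofAdd a) = 1 := by rw [hφψ, ha]; rfl
    have h2 : Multiplicative.ofAdd a = 1 := hφ (by rw [h1, map_one])
    exact h2
  have hd0 : P.det ≠ 0 := by
    intro h
    obtain ⟨v, hv, hv2⟩ := Matrix.exists_mulVec_eq_zero_iff.mpr h
    exact hv (hψ0 v (by rw [hP, hv2]))
  have hinj : Function.Injective (HNNExtension.of : FreeAb 2 → AscHNN φ hφ) :=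
    HNNExtension.of_injective _
  rw [hdet, htr]
  constructor
  · intro hall
    constructor
    · rintro ⟨lam, hlam, a, ha, hla⟩
      refine aux_not_sep (HNNExtension.of (Multiplicative.ofAdd a) : AscHNN φ hφ)
        (HNNExtension.t⁻¹ * HNNExtension.of (Multiplicative.ofAdd a) * HNNExtension.t) ?_ ?_ hall
      · intro N _ _
        have h1 := aux_t_mul (hφ := hφ) (Multiplicative.ofAdd a)
        rw [hφψ, hla, ofAdd_zsmul, map_zpow, ← mul_inv_eq_iff_eq_mul] at h1
        have h2 := congrArg (QuotientGroup.mk' N) h1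
        simp only [map_mul, map_inv, map_zpow] at h2
        have h3 := aux_finite_conj _ _ lam h2
        exact h3
      · intro hm
        obtain ⟨m, hm⟩ := Subgroup.mem_zpowers_iff.mp hm
        have h1 := aux_t_mul (hφ := hφ) (Multiplicative.ofAdd (m • a))
        rw [ofAdd_zsmul, map_zpow, hm, ← ofAdd_zsmul, hφψ, map_zsmul, hla] at h1
        have h2 := hinj (mul_right_cancel (b := HNNExtension.t) (by simpa [mul_assoc] using h1))
        have h3 : a = m • lam • a := h2
        obtain ⟨j, hj⟩ := Function.ne_iff.mp ha
        have h4 := congrFun h3 j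
        simp only [Pi.smul_apply, smul_eq_mul, Pi.zero_apply] at h4 hj
        have h5 : lam * m = 1 := by
          apply mul_right_cancel₀ hj
          linear_combination -h4
        have h6 : IsUnit lam := IsUnit.of_mul_eq_one _ h5
        rw [Int.isUnit_iff_abs_eq] at h6
        omega
    · by_contra hg
      obtain ⟨p, hp, hpg⟩ := Nat.exists_prime_and_dvd hg
      have hpt : (p : ℤ) ∣ P.trace := (Int.natCast_dvd_natCast.mpr hpg).trans (Int.gcd_dvd_left ..)
      have hpd : (p : ℤ) ∣ P.det := (Int.natCast_dvd_natCast.mpr hpg).trans (Int.gcd_dvd_right ..)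
      obtain ⟨u, hu⟩ := hpt
      obtain ⟨v, hv⟩ := hpd
      have hPP : ∀ k : ℕ, P ^ (2 * k) = ((p : ℤ) ^ k) •
          (u • P - v • (1 : Matrix (Fin 2) (Fin 2) ℤ)) ^ k := by
        intro k
        rw [pow_mul, pow_two, aux_CH, hu, hv, ← smul_pow]
        congr 1
        module
      have hit : ∀ (k : ℕ) (a : Fin 2 → ℤ), (φ : FreeAb 2 → FreeAb 2)^[k] (Multiplicative.ofAdd a) =
          Multiplicative.ofAdd ((P ^ k).mulVec a) := by
        intro k
        induction k with
        | zero => intro a; simp only [Function.iterate_zero, id, pow_zero, Matrix.one_mulVec]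
        | succ k ih =>
          intro a
          rw [Function.iterate_succ_apply, hφψ, ih, hP, Matrix.mulVec_mulVec, ← pow_succ]
      let a : Fin 2 → ℤ := fun _ => 1
      refine aux_not_sep ((HNNExtension.of (Multiplicative.ofAdd a) : AscHNN φ hφ) ^ p)
        (HNNExtension.of (Multiplicative.ofAdd a)) ?_ ?_ hall
      · intro N _ _
        refine aux_finite_pow (QuotientGroup.mk' N (HNNExtension.of (Multiplicative.ofAdd a))) hp ?_
        intro k
        have h1 := aux_tpow_mul (hφ := hφ) (2 * k) (Multiplicative.ofAdd a)
        rw [hit, hPP, Matrix.smul_mulVec, ofAdd_zsmul, ← mul_inv_eq_iff_eq_mul, map_zpow,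
          ← Nat.cast_pow, zpow_natCast] at h1
        have h2 := congrArg (QuotientGroup.mk' N) h1
        rw [map_mul, map_mul, map_inv, map_pow _ _ (p ^ k)] at h2
        exact ⟨_, _, h2⟩
      · intro hm
        obtain ⟨m, hm⟩ := Subgroup.mem_zpowers_iff.mp hm
        rw [← map_pow, ← map_zpow, ← ofAdd_nsmul, ← ofAdd_zsmul] at hm
        have h3 : m • p • a = a := hinj hm
        have h4 := congrFun h3 0
        simp [a] at h4
        have h6 : IsUnit (p : ℤ) := IsUnit.of_mul_eq_one m (by linarith)
        exact (Nat.prime_iff_prime_int.mp hp).not_isUnit h6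
  · rintro ⟨hev, hg⟩ g h hgh
    have H : ∀ a b : FreeAb 2, b ∉ Subgroup.zpowers a →
        AuxSep (HNNExtension.of a : AscHNN φ hφ) (HNNExtension.of b) := by
      intro a b hab
      have hab' : ∀ i : ℤ, b.toAdd ≠ i • a.toAdd := by
        intro i hi
        apply hab
        refine Subgroup.mem_zpowers_iff.mpr ⟨i, ?_⟩
        exact hi.symm
      simp only [hP] at hev
      obtain ⟨N, hN, hN2⟩ := aux_main P hd0 hg hev a.toAdd b.toAdd hab'
      obtain ⟨F, i1, i2, f, n, hf⟩ := aux_hom ψ φ hφψ hφ P hP N hN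
      refine ⟨F, i1, i2, f, fun hm => ?_⟩
      obtain ⟨i, hi⟩ := hf a.toAdd b.toAdd hm
      exact hN2 n i hi
    obtain ⟨F, i1, i2, f, hf⟩ := aux_all H g h hgh
    exact aux_sep_of_hom f g h hf
end
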